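/- arXiv:2007.06652 — 2 statements merged into one kernel-verified Lean document; each statement's English description precedes it below -/
import Mathlib

section
/- For each prime p ∈ {2, 3, 5, 7, 11, 13}, there exists δ_p > 0 such that the proportion of entries of the character table of S_n not divisible by p is O_p(n^{-δ_p}); i.e., #{(λ,μ) : λ, μ ⊢ n, p ∤ χ^λ_μ} ≤ C_p·n^{-δ_p}·p(n)². -/
open scoped BigOperators

/-- Irreducible character of `S_n` via the Frobenius character formula. -/
noncomputable def charSn (n : ℕ) (lam mu : Nat.Partition n) : ℤ :=
  MvPolynomial.coeff
    (Finsupp.equivFunOnFinite.symm fun i : Fin n =>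
      ((lam.parts.sort (· ≤ ·)).reverse.getD i 0) + (n - 1 - (i : ℕ)))
    ((∏ i : Fin n, ∏ j ∈ Finset.univ.filter (fun j : Fin n => (i : ℕ) < (j : ℕ)),
        (MvPolynomial.X i - MvPolynomial.X j)) *
      (mu.parts.map (fun m => ∑ i : Fin n, MvPolynomial.X i ^ m)).prod)


open MeasureTheory ProbabilityTheory

lemma mem_parts_Icc {n : ℕ} (μ : Nat.Partition n) (k : ℕ) (hk : k ∈ μ.parts) :
    k ∈ Finset.Icc 1 n :=
  Finset.mem_Icc.2 ⟨μ.parts_pos hk, μ.le_of_mem_parts hk⟩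

lemma sum_mul_count {n : ℕ} (μ : Nat.Partition n) :
    ∑ k ∈ Finset.Icc 1 n, k * μ.parts.count k = n := by
  have h := Finset.sum_multiset_map_count μ.parts (fun x => x)
  rw [Multiset.map_id', μ.parts_sum] at h
  refine Eq.trans (Eq.symm ?_) h.symm
  apply Finset.sum_subset_zero_on_sdiff
  · intro k hk; exact mem_parts_Icc μ k (Multiset.mem_toFinset.1 hk)
  · intro k hk
    have : k ∉ μ.parts := fun h => (Finset.mem_sdiff.1 hk).2 (Multiset.mem_toFinset.2 h)
    simp [Multiset.count_eq_zero_of_notMem this]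
  · intro k _; simp [mul_comm]

lemma boltz_exists (q : ℝ) (hq0 : 0 < q) (hq1 : q < 1) :
    ∃ (Ω : Type) (_ : MeasurableSpace Ω) (P : Measure Ω) (_ : IsProbabilityMeasure P)
      (a : ℕ → Ω → ℕ), (∀ k, Measurable (a k)) ∧ iIndepFun a P ∧
      ∀ k, 1 ≤ k → ∀ j, P.real {ω | a k ω = j} = (q ^ k) ^ j * (1 - q ^ k) := by
  have hmem : ∀ k : ℕ, (1 - q ^ k) ∈ unitInterval := fun k =>
    ⟨by have := pow_le_one₀ hq0.le hq1.le (n := k); linarith,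
     by have := pow_pos hq0 k; linarith⟩
  let pr : ℕ → unitInterval := fun k => ⟨1 - q ^ k, hmem k⟩
  refine ⟨ℕ → ℕ, inferInstance, Measure.infinitePi (fun k => geometricMeasure (pr k)),
    inferInstance, fun k ω => ω k, fun k => measurable_pi_apply k,
    iIndepFun_infinitePi (X := fun _ x => x) (fun _ => measurable_id), ?_⟩
  intro k hk j
  have h1 : (Measure.infinitePi (fun k => geometricMeasure (pr k))).map (fun ω => ω k)
      = geometricMeasure (pr k) := Measure.infinitePi_map_eval _ k
  have h2 : {ω : ℕ → ℕ | ω k = j} = (fun ω => ω k) ⁻¹' {j} := by ext; simp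
  rw [h2, ← map_measureReal_apply (measurable_pi_apply k) (measurableSet_singleton j), h1]
  have hne : pr k ≠ 0 := by
    intro h
    have := congrArg Subtype.val h
    have hlt := pow_lt_one₀ hq0.le hq1 (n := k) (by omega)
    simp [pr] at this
    linarith
  rw [geometricMeasure_real_singleton hne]
  simp [pr]

section
variable {Ω : Type} [MeasurableSpace Ω] {P : Measure Ω} [IsProbabilityMeasure P]
  {a : ℕ → Ω → ℕ}

lemma meas_dep (S : Finset ℕ) (Q : (ℕ → ℕ) → Prop)
    (hQ : ∀ f f', (∀ k ∈ S, f k = f' k) → Q f → Q f') :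
    ∃ U : Set (S → ℕ), MeasurableSet U ∧
      {ω | Q (fun k => a k ω)} = (fun ω (k : S) => a k ω) ⁻¹' U := by
  classical
  refine ⟨{f | Q (fun k => if h : k ∈ S then f ⟨k, h⟩ else 0)}, MeasurableSet.of_discrete, ?_⟩
  ext ω
  simp only [Set.mem_ofPred_eq, Set.mem_preimage]
  constructor
  · apply hQ; intro k hk; simp [hk]
  · apply hQ; intro k hk; simp [hk]

lemma measSet_dep (ha : ∀ k, Measurable (a k)) (S : Finset ℕ) (Q : (ℕ → ℕ) → Prop)
    (hQ : ∀ f f', (∀ k ∈ S, f k = f' k) → Q f → Q f') :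
    MeasurableSet {ω | Q (fun k => a k ω)} := by
  obtain ⟨U, hU, h⟩ := meas_dep (a := a) S Q hQ
  rw [h]
  have hm : Measurable (fun ω (k : S) => a k ω) := measurable_pi_iff.2 fun k => ha k
  exact hm hU

lemma indep_inter (ha : ∀ k, Measurable (a k)) (hi : iIndepFun a P) {κ : Type}
    (g : Finset κ) (S : κ → Finset ℕ) (Q : κ → (ℕ → ℕ) → Prop)
    (hQ : ∀ i ∈ g, ∀ f f', (∀ k ∈ S i, f k = f' k) → Q i f → Q i f')
    (hd : ∀ i ∈ g, ∀ j ∈ g, i ≠ j → Disjoint (S i) (S j)) :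
    P.real {ω | ∀ i ∈ g, Q i (fun k => a k ω)} = ∏ i ∈ g, P.real {ω | Q i (fun k => a k ω)} := by
  classical
  induction g using Finset.induction_on with
  | empty => simp
  | insert i g hig ih =>
    have ih' := ih (fun i hi => hQ i (Finset.mem_insert_of_mem hi))
      (fun i hi j hj => hd i (Finset.mem_insert_of_mem hi) j (Finset.mem_insert_of_mem hj))
    rw [Finset.prod_insert hig, ← ih']
    obtain ⟨U, hU, hU'⟩ := meas_dep (a := a) (S i) (Q i) (hQ i (Finset.mem_insert_self _ _))
    obtain ⟨V, hV, hV'⟩ := meas_dep (a := a) (g.biUnion S) (fun f => ∀ j ∈ g, Q j f) (by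
      intro f f' hff h j hj
      exact hQ j (Finset.mem_insert_of_mem hj) f f'
        (fun k hk => hff k (Finset.mem_biUnion.2 ⟨j, hj, hk⟩)) (h j hj))
    have hdis : Disjoint (S i) (g.biUnion S) := by
      rw [Finset.disjoint_biUnion_right]
      intro j hj
      exact hd i (Finset.mem_insert_self _ _) j (Finset.mem_insert_of_mem hj)
        (fun h => hig (h ▸ hj))
    have hind := hi.indepFun_finset (S i) (g.biUnion S) hdis ha
    have := hind.measure_inter_preimage_eq_mul U V hU hV
    rw [← hU', ← hV'] at this
    have hset : {ω | ∀ i_1 ∈ insert i g, Q i_1 fun k => a k ω} =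
        {ω | Q i fun k => a k ω} ∩ {ω | ∀ j ∈ g, Q j fun k => a k ω} := by
      ext ω; simp
    rw [hset, measureReal_def, this, ENNReal.toReal_mul]
    rfl

variable {q : ℝ}

lemma tail_prob (ha : ∀ k, Measurable (a k))
    (hP : ∀ k, 1 ≤ k → ∀ j, P.real {ω | a k ω = j} = (q ^ k) ^ j * (1 - q ^ k))
    (k : ℕ) (hk : 1 ≤ k) (j : ℕ) : P.real {ω | j ≤ a k ω} = (q ^ k) ^ j := by
  induction j with
  | zero => simp
  | succ j ih =>
    have h : {ω | j ≤ a k ω} = {ω | j + 1 ≤ a k ω} ∪ {ω | a k ω = j} := by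
      ext ω; simp only [Set.mem_ofPred_eq, Set.mem_union]; omega
    have hd : Disjoint {ω | j + 1 ≤ a k ω} {ω | a k ω = j} := by
      rw [Set.disjoint_left]; intro ω h1 h2; simp only [Set.mem_ofPred_eq] at h1 h2; omega
    have hm : MeasurableSet {ω | a k ω = j} := ha k (measurableSet_singleton j)
    have := measureReal_union (μ := P) hd hm
    rw [← h, ih, hP k hk j] at this
    have e : (q ^ k) ^ (j + 1) = (q ^ k) ^ j * q ^ k := pow_succ _ _
    rw [e]; linarith

/-- the pair estimate -/
lemma pair_prob (ha : ∀ k, Measurable (a k)) (hi : iIndepFun a P)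
    (hP : ∀ k, 1 ≤ k → ∀ j, P.real {ω | a k ω = j} = (q ^ k) ^ j * (1 - q ^ k))
    (k : ℕ) (hk : 1 ≤ k) (p : ℕ) (hp : 2 ≤ p) (B : ℕ) :
    (B : ℝ) * (1 - q ^ (k * p)) * q ^ (k * p * B) ≤
      P.real {ω | p * B ≤ a k ω + p * a (k * p) ω} := by
  classical
  have hkp : k * p ≠ k := by nlinarith
  have hkp1 : 1 ≤ k * p := by nlinarith
  have hsub : (⋃ b ∈ Finset.range B, {ω | a (k * p) ω = b} ∩ {ω | p * (B - b) ≤ a k ω}) ⊆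
      {ω | p * B ≤ a k ω + p * a (k * p) ω} := by
    intro ω hω
    simp only [Set.mem_iUnion, Finset.mem_range, Set.mem_inter_iff, Set.mem_ofPred_eq] at hω ⊢
    obtain ⟨b, hb, h1, h2⟩ := hω
    rw [h1]
    obtain ⟨d, rfl⟩ := Nat.exists_eq_add_of_lt hb
    have : b + d + 1 - b = d + 1 := by omega
    rw [this] at h2
    nlinarith
  have hmeas : ∀ b ∈ Finset.range B,
      MeasurableSet ({ω | a (k * p) ω = b} ∩ {ω | p * (B - b) ≤ a k ω}) := fun b _ =>
    (ha _ (measurableSet_singleton b)).inter (ha k (MeasurableSet.of_discrete (s := Set.Ici _)))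
  have hval : ∀ b ∈ Finset.range B,
      P.real ({ω | a (k * p) ω = b} ∩ {ω | p * (B - b) ≤ a k ω}) =
        (1 - q ^ (k * p)) * q ^ (k * p * B) := by
    intro b hb
    have hbB : b < B := Finset.mem_range.1 hb
    have hind := hi.indepFun hkp
    have := hind.measure_inter_preimage_eq_mul {b} (Set.Ici (p * (B - b)))
      (measurableSet_singleton b) MeasurableSet.of_discrete
    have e : P.real ({ω | a (k * p) ω = b} ∩ {ω | p * (B - b) ≤ a k ω}) =
        P.real {ω | a (k * p) ω = b} * P.real {ω | p * (B - b) ≤ a k ω} := by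
      simp only [measureReal_def]
      rw [← ENNReal.toReal_mul]
      exact congrArg _ this
    rw [e, hP _ hkp1, tail_prob ha hP k hk]
    have : (q ^ (k * p)) ^ b * (q ^ k) ^ (p * (B - b)) = q ^ (k * p * B) := by
      rw [← pow_mul, ← pow_mul, ← pow_add]
      congr 1
      obtain ⟨d, rfl⟩ := Nat.exists_eq_add_of_lt hbB
      have : b + d + 1 - b = d + 1 := by omega
      rw [this]; ring
    rw [← this]; ring
  calc (B : ℝ) * (1 - q ^ (k * p)) * q ^ (k * p * B)
      = ∑ b ∈ Finset.range B, P.real ({ω | a (k * p) ω = b} ∩ {ω | p * (B - b) ≤ a k ω}) := by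
        rw [Finset.sum_congr rfl hval]; simp; ring
    _ = P.real (⋃ b ∈ Finset.range B, {ω | a (k * p) ω = b} ∩ {ω | p * (B - b) ≤ a k ω}) := by
        rw [measureReal_biUnion_finset _ hmeas]
        intro b _ b' _ hbb
        rw [Function.onFun, Set.disjoint_left]
        rintro ω ⟨h1, _⟩ ⟨h2, _⟩
        exact hbb (h1.symm.trans h2)
    _ ≤ _ := measureReal_mono hsub

/-- transfer from the Boltzmann model to partitions of `n` -/
lemma card_le_prob (ha : ∀ k, Measurable (a k)) (hi : iIndepFun a P)
    (hP : ∀ k, 1 ≤ k → ∀ j, P.real {ω | a k ω = j} = (q ^ k) ^ j * (1 - q ^ k))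
    (n : ℕ) (E : Finset (Nat.Partition n)) (Bad : Set Ω)
    (hE : ∀ μ ∈ E, ∀ ω, (∀ k ∈ Finset.Icc 1 n, a k ω = μ.parts.count k) → ω ∈ Bad) :
    (E.card : ℝ) * (q ^ n * ∏ k ∈ Finset.Icc 1 n, (1 - q ^ k)) ≤ P.real Bad := by
  classical
  let W : Nat.Partition n → Set Ω := fun μ => {ω | ∀ k ∈ Finset.Icc 1 n, a k ω = μ.parts.count k}
  have hmem : ∀ (μ : Nat.Partition n) k, k ∈ μ.parts → k ∈ Finset.Icc 1 n := mem_parts_Icc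
  have hsum : ∀ μ : Nat.Partition n, ∑ k ∈ Finset.Icc 1 n, k * μ.parts.count k = n := sum_mul_count
  have hW : ∀ μ, P.real (W μ) = q ^ n * ∏ k ∈ Finset.Icc 1 n, (1 - q ^ k) := by
    intro μ
    have := indep_inter (P := P) ha hi (Finset.Icc 1 n) (fun k => {k})
      (fun k f => f k = μ.parts.count k)
      (by intro i _ f f' h h'; rw [← h i (by simp)]; exact h')
      (by intro i _ j _ hij; simpa using hij)
    change P.real {ω | ∀ k ∈ Finset.Icc 1 n, a k ω = μ.parts.count k} = _
    rw [this, Finset.prod_congr rfl (fun k hk => hP k (Finset.mem_Icc.1 hk).1 _),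
      Finset.prod_mul_distrib]
    congr 1
    rw [Finset.prod_congr rfl (fun k _ => (pow_mul q k _).symm), Finset.prod_pow_eq_pow_sum, hsum]
  have hWm : ∀ μ, MeasurableSet (W μ) := by
    intro μ
    exact measSet_dep ha (Finset.Icc 1 n) (fun f => ∀ k ∈ Finset.Icc 1 n, f k = μ.parts.count k)
      (by intro f f' h h' k hk; rw [← h k hk]; exact h' k hk)
  calc (E.card : ℝ) * (q ^ n * ∏ k ∈ Finset.Icc 1 n, (1 - q ^ k))
      = ∑ μ ∈ E, P.real (W μ) := by rw [Finset.sum_congr rfl (fun μ _ => hW μ)]; simp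
    _ = P.real (⋃ μ ∈ E, W μ) := by
        rw [measureReal_biUnion_finset _ (fun μ _ => hWm μ)]
        intro μ _ ν _ hne
        rw [Function.onFun, Set.disjoint_left]
        intro ω h1 h2
        apply hne
        ext k
        by_cases hk : k ∈ Finset.Icc 1 n
        · rw [← h1 k hk, ← h2 k hk]
        · rw [Multiset.count_eq_zero_of_notMem (fun h => hk (hmem μ k h)),
            Multiset.count_eq_zero_of_notMem (fun h => hk (hmem ν k h))]
    _ ≤ _ := by
        refine measureReal_mono ?_ (measure_ne_top _ _)
        intro ω hω
        simp only [Set.mem_iUnion] at hω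
        obtain ⟨μ, hμ, h⟩ := hω
        exact hE μ hμ ω h
end

open MeasureTheory ProbabilityTheory

noncomputable def Zc : ℝ := ∑' j : ℕ, 1 / ((j : ℝ) + 1) ^ 2
noncomputable def cc : ℝ := Real.sqrt Zc

lemma Zc_summable : Summable (fun j : ℕ => 1 / ((j : ℝ) + 1) ^ 2) := by
  have := (summable_nat_add_iff 1).2 (Real.summable_one_div_nat_pow (p := 2).2 (by norm_num))
  simpa using this

lemma one_le_Zc : 1 ≤ Zc := by
  have := Zc_summable.le_tsum 0 (fun j _ => by positivity)
  simpa [Zc] using this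

lemma cc_sq : cc ^ 2 = Zc := Real.sq_sqrt (by linarith [one_le_Zc])
lemma one_le_cc : 1 ≤ cc := by
  rw [cc, Real.one_le_sqrt]; exact one_le_Zc
lemma cc_pos : 0 < cc := by linarith [one_le_cc]

lemma geom_exp_le (y : ℝ) (hy : 0 < y) (n : ℕ) :
    ∑ k ∈ Finset.Icc 1 n, (Real.exp (-y)) ^ k ≤ 1 / y := by
  have hr0 : 0 < Real.exp (-y) := Real.exp_pos _
  have hr1 : Real.exp (-y) < 1 := by rw [Real.exp_lt_one_iff]; linarith
  have h1 : ∀ n : ℕ, ∑ k ∈ Finset.Icc 1 n, (Real.exp (-y)) ^ k * (1 - Real.exp (-y)) =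
      Real.exp (-y) - (Real.exp (-y)) ^ (n + 1) := by
    intro n
    induction n with
    | zero => simp
    | succ n ih => rw [Finset.sum_Icc_succ_top (by omega), ih]; ring
  have h2 := h1 n
  rw [← Finset.sum_mul] at h2
  have h3 : (∑ k ∈ Finset.Icc 1 n, (Real.exp (-y)) ^ k) * (1 - Real.exp (-y)) ≤ Real.exp (-y) := by
    rw [h2]; have := pow_pos hr0 (n + 1); linarith
  have h4 : y * Real.exp (-y) ≤ 1 - Real.exp (-y) := by
    have := Real.add_one_le_exp y
    have e : Real.exp y * Real.exp (-y) = 1 := by rw [← Real.exp_add]; simp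
    nlinarith
  rw [le_div_iff₀ hy]
  have h5 : 0 ≤ ∑ k ∈ Finset.Icc 1 n, (Real.exp (-y)) ^ k :=
    Finset.sum_nonneg (fun k _ => by positivity)
  have h6 : (∑ k ∈ Finset.Icc 1 n, (Real.exp (-y)) ^ k) * (y * Real.exp (-y)) ≤ Real.exp (-y) :=
    (mul_le_mul_of_nonneg_left h4 h5).trans h3
  by_contra hc
  push Not at hc
  nlinarith

lemma prod_lower (x : ℝ) (hx : 0 < x) (n : ℕ) :
    Real.exp (-(Zc / x)) ≤ ∏ k ∈ Finset.Icc 1 n, (1 - Real.exp (-x) ^ k) := by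
  have hr0 : 0 < Real.exp (-x) := Real.exp_pos _
  have hr1 : Real.exp (-x) < 1 := by rw [Real.exp_lt_one_iff]; linarith
  have hk1 : ∀ k ∈ Finset.Icc 1 n, Real.exp (-x) ^ k < 1 := fun k hk =>
    pow_lt_one₀ hr0.le hr1 (by have := (Finset.mem_Icc.1 hk).1; omega)
  have hpos : ∀ k ∈ Finset.Icc 1 n, 0 < 1 - Real.exp (-x) ^ k := fun k hk => by
    linarith [hk1 k hk]
  rw [← Real.le_log_iff_exp_le (Finset.prod_pos hpos),
    Real.log_prod (fun k hk => (hpos k hk).ne')]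
  have hs : ∀ k ∈ Finset.Icc 1 n, HasSum (fun j : ℕ => (Real.exp (-x) ^ k) ^ (j + 1) / ((j : ℝ) + 1))
      (-Real.log (1 - Real.exp (-x) ^ k)) := fun k hk =>
    Real.hasSum_pow_div_log_of_abs_lt_one (by
      rw [abs_of_pos (pow_pos hr0 k)]; exact hk1 k hk)
  have hs' := hasSum_sum hs
  have hle := hasSum_le (f := fun j : ℕ => ∑ k ∈ Finset.Icc 1 n, (Real.exp (-x) ^ k) ^ (j + 1) / ((j : ℝ) + 1))
    (g := fun j : ℕ => (1 / ((j : ℝ) + 1) ^ 2) * (1 / x)) ?_ hs' (Zc_summable.hasSum.mul_right (1 / x))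
  · rw [Finset.sum_neg_distrib] at hle
    have : (∑' j : ℕ, 1 / ((j : ℝ) + 1) ^ 2) * (1 / x) = Zc / x := by rw [Zc]; ring
    rw [this] at hle
    linarith
  · intro j
    have := geom_exp_le (x * (j + 1)) (by positivity) n
    have e : ∀ k ∈ Finset.Icc 1 n, (Real.exp (-x) ^ k) ^ (j + 1) / ((j : ℝ) + 1) =
        Real.exp (-(x * (j + 1))) ^ k / ((j : ℝ) + 1) := by
      intro k _
      congr 1
      rw [← pow_mul, ← Real.exp_nat_mul, ← Real.exp_nat_mul]
      congr 1; push_cast; ring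
    rw [Finset.sum_congr rfl e, ← Finset.sum_div]
    calc _ ≤ (1 / (x * (j + 1))) / ((j : ℝ) + 1) := by gcongr
      _ = _ := by field_simp

/-- number of partitions in a bad set vs. Boltzmann probability, `x = cc / √n` -/
lemma boltz_const (n : ℕ) (hn : 1 ≤ n) :
    Real.exp (-(2 * cc * Real.sqrt n)) ≤
      Real.exp (-(cc / Real.sqrt n)) ^ n *
        ∏ k ∈ Finset.Icc 1 n, (1 - Real.exp (-(cc / Real.sqrt n)) ^ k) := by
  have hn0 : (0 : ℝ) < n := by exact_mod_cast hn
  have hs : 0 < Real.sqrt n := Real.sqrt_pos.2 hn0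
  have hx : 0 < cc / Real.sqrt n := div_pos cc_pos hs
  have h := prod_lower (cc / Real.sqrt n) hx n
  have hss : Real.sqrt n * Real.sqrt n = n := Real.mul_self_sqrt hn0.le
  have e1 : Zc / (cc / Real.sqrt n) = cc * Real.sqrt n := by
    rw [← cc_sq]; have := cc_pos; field_simp
  have e2 : Real.exp (-(cc / Real.sqrt n)) ^ n = Real.exp (-(cc * Real.sqrt n)) := by
    rw [← Real.exp_nat_mul]
    congr 1
    field_simp
    rw [Real.sq_sqrt hn0.le]; ring
  rw [e1] at h
  rw [e2]
  calc Real.exp (-(2 * cc * Real.sqrt n)) =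
      Real.exp (-(cc * Real.sqrt n)) * Real.exp (-(cc * Real.sqrt n)) := by
        rw [← Real.exp_add]; congr 1; ring
    _ ≤ _ := by gcongr

lemma part_upper (n : ℕ) :
    (Fintype.card (Nat.Partition n) : ℝ) ≤ Real.exp (2 * cc * Real.sqrt n) := by
  rcases Nat.eq_zero_or_pos n with rfl | hn
  · simp
  have hn0 : (0 : ℝ) < n := by exact_mod_cast hn
  have hs : 0 < Real.sqrt n := Real.sqrt_pos.2 hn0
  have hx : 0 < cc / Real.sqrt n := div_pos cc_pos hs
  obtain ⟨Ω, _, P, _, a, ha, hi, hP⟩ := boltz_exists (Real.exp (-(cc / Real.sqrt n)))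
    (Real.exp_pos _) (by rw [Real.exp_lt_one_iff]; linarith)
  have h := card_le_prob ha hi hP n Finset.univ Set.univ (fun _ _ _ _ => trivial)
  have h2 := boltz_const n hn
  rw [probReal_univ, Finset.card_univ] at h
  have h3 : (Fintype.card (Nat.Partition n) : ℝ) * Real.exp (-(2 * cc * Real.sqrt n)) ≤ 1 :=
    (mul_le_mul_of_nonneg_left h2 (by positivity)).trans h
  rwa [Real.exp_neg, ← div_eq_mul_inv, div_le_one (Real.exp_pos _)] at h3


lemma card_count_ge (n k j : ℕ) (hk : 1 ≤ k) (h : k * j ≤ n) :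
    Fintype.card (Nat.Partition (n - k * j)) ≤
      (Finset.univ.filter (fun μ : Nat.Partition n => j ≤ μ.parts.count k)).card := by
  classical
  rw [← Finset.card_univ]
  let F : Nat.Partition (n - k * j) → Nat.Partition n := fun ν =>
    { parts := ν.parts + Multiset.replicate j k
      parts_pos := by
        intro i hi
        rcases Multiset.mem_add.1 hi with h1 | h1
        · exact ν.parts_pos h1
        · rw [Multiset.eq_of_mem_replicate h1]; omega
      parts_sum := by
        rw [Multiset.sum_add, ν.parts_sum, Multiset.sum_replicate, smul_eq_mul, mul_comm j k]
        omega }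
  apply Finset.card_le_card_of_injOn F
  · intro ν _
    simp [F]
  · intro ν _ ν' _ hh
    have := congrArg Nat.Partition.parts hh
    simp only [F, add_left_inj] at this
    exact Nat.Partition.ext this

lemma erdos_ineq (n : ℕ) (T : Finset (ℕ × ℕ)) (hT : ∀ t ∈ T, (t.1 + 1) * (t.2 + 1) ≤ n) :
    ∑ t ∈ T, (t.2 + 1) * Fintype.card (Nat.Partition (n - (t.1 + 1) * (t.2 + 1))) ≤
      n * Fintype.card (Nat.Partition n) := by
  classical
  have h1 : n * Fintype.card (Nat.Partition n) =
      ∑ μ : Nat.Partition n, ∑ k ∈ Finset.Icc 1 n, k * μ.parts.count k := by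
    rw [Finset.sum_congr rfl (fun μ _ => sum_mul_count μ)]
    simp [mul_comm]
  have h2 : ∀ (μ : Nat.Partition n), ∀ k ∈ Finset.Icc 1 n, μ.parts.count k =
      ∑ j ∈ Finset.Icc 1 n, if j ≤ μ.parts.count k then 1 else 0 := by
    intro μ k hk
    have hle : μ.parts.count k ≤ n := by
      have h := Finset.single_le_sum (f := fun k => k * μ.parts.count k) (fun i _ => Nat.zero_le _) hk
      rw [sum_mul_count μ] at h
      have := (Finset.mem_Icc.1 hk).1
      nlinarith
    rw [← Finset.card_filter]
    have : (Finset.Icc 1 n).filter (fun j => j ≤ μ.parts.count k) = Finset.Icc 1 (μ.parts.count k) := by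
      ext j; simp only [Finset.mem_filter, Finset.mem_Icc]; omega
    rw [this]; simp
  have h3 : n * Fintype.card (Nat.Partition n) =
      ∑ k ∈ Finset.Icc 1 n, ∑ j ∈ Finset.Icc 1 n,
        k * (Finset.univ.filter (fun μ : Nat.Partition n => j ≤ μ.parts.count k)).card := by
    rw [h1, Finset.sum_comm]
    apply Finset.sum_congr rfl
    intro k hk
    rw [← Finset.mul_sum, ← Finset.mul_sum]
    congr 1
    rw [Finset.sum_congr rfl (fun μ _ => h2 μ k hk), Finset.sum_comm]
    apply Finset.sum_congr rfl
    intro j _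
    rw [Finset.card_filter]
  rw [h3, ← Finset.sum_product' (f := fun k j => k * (Finset.univ.filter (fun μ : Nat.Partition n => j ≤ μ.parts.count k)).card)]
  calc ∑ t ∈ T, (t.2 + 1) * Fintype.card (Nat.Partition (n - (t.1 + 1) * (t.2 + 1)))
      ≤ ∑ t ∈ T, (t.2 + 1) *
        (Finset.univ.filter (fun μ : Nat.Partition n => t.1 + 1 ≤ μ.parts.count (t.2 + 1))).card := by
        apply Finset.sum_le_sum
        intro t ht
        have h4 := hT t ht
        have := card_count_ge n (t.2 + 1) (t.1 + 1) (by omega) (by rw [mul_comm]; exact h4)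
        rw [mul_comm (t.2 + 1) (t.1 + 1)] at this
        exact Nat.mul_le_mul_left _ this
    _ = ∑ s ∈ T.image (fun t => (t.2 + 1, t.1 + 1)), s.1 *
        (Finset.univ.filter (fun μ : Nat.Partition n => s.2 ≤ μ.parts.count s.1)).card := by
        rw [Finset.sum_image]
        intro t _ t' _ h
        simp only [Prod.mk.injEq] at h
        ext <;> omega
    _ ≤ _ := by
        apply Finset.sum_le_sum_of_subset
        intro s hs
        obtain ⟨t, ht, rfl⟩ := Finset.mem_image.1 hs
        have := hT t ht
        simp only [Finset.mem_product, Finset.mem_Icc]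
        refine ⟨⟨by omega, by nlinarith⟩, by omega, by nlinarith⟩

noncomputable def phi (y : ℝ) : ℝ := Real.exp (-y) / (1 - Real.exp (-y)) ^ 2

lemma phi_nonneg (y : ℝ) : 0 ≤ phi y := by unfold phi; positivity

lemma phi_eq (y : ℝ) (hy : 0 < y) : phi y = 1 / (2 * Real.cosh y - 2) := by
  have hr1 : Real.exp (-y) < 1 := by rw [Real.exp_lt_one_iff]; linarith
  have h0 := Real.exp_pos (-y)
  have e : Real.exp y * Real.exp (-y) = 1 := by rw [← Real.exp_add]; simp
  have h2 : (2 * Real.cosh y - 2) * Real.exp (-y) = (1 - Real.exp (-y)) ^ 2 := by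
    rw [Real.cosh_eq]; linear_combination e
  have h3 : 0 < (1 - Real.exp (-y)) ^ 2 := by have : 0 < 1 - Real.exp (-y) := by linarith
                                              positivity
  have h4 : 2 * Real.cosh y - 2 ≠ 0 := by intro h; rw [h] at h2; simp at h2; linarith
  unfold phi
  rw [← h2]; field_simp

lemma phi_le (y : ℝ) (hy : 0 < y) : phi y ≤ 1 / y ^ 2 := by
  rw [phi_eq y hy]
  apply one_div_le_one_div_of_le (by positivity)
  have h1 : Real.cosh y = 2 * Real.sinh (y / 2) ^ 2 + 1 := by
    have := Real.cosh_two_mul (y / 2)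
    rw [show 2 * (y / 2) = y by ring] at this
    have h3 := Real.cosh_sq (y / 2)
    rw [this, h3]; ring
  have h2 : y / 2 ≤ Real.sinh (y / 2) := Real.self_le_sinh_iff.2 (by linarith)
  rw [h1]; nlinarith

lemma le_phi (y : ℝ) (hy : 0 < y) (hy1 : y ≤ 1) : 1 / y ^ 2 - 1 / 2 ≤ phi y := by
  rw [phi_eq y hy]
  have h1 := Real.cosh_le_exp_half_sq y
  have h2 : Real.exp (y ^ 2 / 2) ≤ 1 + y ^ 2 / 2 + (y ^ 2 / 2) ^ 2 := by
    have := Real.abs_exp_sub_one_sub_id_le (x := y ^ 2 / 2)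
      (by rw [abs_of_nonneg (by positivity)]; nlinarith)
    have := (abs_le.1 this).2
    linarith
  have hc : 1 < Real.cosh y := Real.one_lt_cosh.2 hy.ne'
  have h3 : 2 * Real.cosh y - 2 ≤ y ^ 2 * (1 + y ^ 2 / 2) := by nlinarith
  calc 1 / y ^ 2 - 1 / 2 ≤ 1 / (y ^ 2 * (1 + y ^ 2 / 2)) := by
        rw [div_sub_div _ _ (by positivity) (by norm_num), div_le_div_iff₀ (by positivity) (by positivity)]
        have : 0 ≤ y ^ 6 := by positivity
        nlinarith
    _ ≤ _ := one_div_le_one_div_of_le (by linarith) h3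

noncomputable def ww (x : ℝ) (t : ℕ × ℕ) : ℝ :=
  ((t.2 : ℝ) + 1) * Real.exp (-(x * (((t.1 : ℝ) + 1) * ((t.2 : ℝ) + 1))))

lemma ww_inner (x : ℝ) (hx : 0 < x) (j : ℕ) :
    HasSum (fun k => ww x (j, k)) (phi (x * ((j : ℝ) + 1))) := by
  set r := Real.exp (-(x * ((j : ℝ) + 1))) with hr
  have hr0 : 0 < r := Real.exp_pos _
  have hr1 : r < 1 := by rw [hr, Real.exp_lt_one_iff]; have : 0 < x * ((j : ℝ) + 1) := by positivity
                         linarith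
  have h := hasSum_coe_mul_geometric_of_norm_lt_one (𝕜 := ℝ) (r := r)
    (by rw [Real.norm_eq_abs, abs_of_pos hr0]; exact hr1)
  rw [← hasSum_nat_add_iff' 1] at h
  simp only [Finset.range_one, Finset.sum_singleton, Nat.cast_zero, zero_mul, sub_zero] at h
  have hphi : phi (x * ((j : ℝ) + 1)) = r / (1 - r) ^ 2 := rfl
  rw [hphi]
  convert! h using 1
  funext k
  simp only [ww, hr]
  rw [← Real.exp_nat_mul]
  push_cast
  congr 2; ring

lemma phi_summable (x : ℝ) (hx : 0 < x) : Summable (fun j : ℕ => phi (x * ((j : ℝ) + 1))) := by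
  refine Summable.of_nonneg_of_le (fun j => phi_nonneg _) (fun j => phi_le _ (by positivity)) ?_
  have := Zc_summable.mul_left (1 / x ^ 2)
  refine this.congr (fun j => ?_)
  field_simp

lemma ww_summable (x : ℝ) (hx : 0 < x) : Summable (ww x) := by
  rw [summable_prod_of_nonneg (fun t => by unfold ww; positivity)]
  refine ⟨fun j => (ww_inner x hx j).summable, ?_⟩
  refine (phi_summable x hx).congr (fun j => ?_)
  rw [(ww_inner x hx j).tsum_eq]

lemma ww_tsum (x : ℝ) (hx : 0 < x) : ∑' t, ww x t = ∑' j : ℕ, phi (x * ((j : ℝ) + 1)) := by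
  rw [(ww_summable x hx).tsum_prod]
  congr 1; ext j; rw [(ww_inner x hx j).tsum_eq]

lemma S_upper (x : ℝ) (hx : 0 < x) : ∑' t, ww x t ≤ Zc / x ^ 2 := by
  rw [ww_tsum x hx, Zc, ← tsum_div_const]
  refine (phi_summable x hx).tsum_le_tsum (fun j => ?_) (Zc_summable.div_const _)
  refine (phi_le _ (by positivity)).trans (le_of_eq ?_)
  field_simp

lemma Zc_tail (M : ℕ) (hM : 1 ≤ M) :
    Zc ≤ ∑ j ∈ Finset.range M, 1 / ((j : ℝ) + 1) ^ 2 + 1 / M := by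
  have hM0 : (0 : ℝ) < M := by exact_mod_cast hM
  have h : ∀ d : ℕ, ∑ j ∈ Finset.range (M + d), 1 / ((j : ℝ) + 1) ^ 2 ≤
      ∑ j ∈ Finset.range M, 1 / ((j : ℝ) + 1) ^ 2 + 1 / M - 1 / ((M : ℝ) + d) := by
    intro d
    induction d with
    | zero => simp
    | succ d ih =>
      rw [← add_assoc, Finset.sum_range_succ]
      have : 1 / (((M + d : ℕ) : ℝ) + 1) ^ 2 ≤ 1 / ((M : ℝ) + d) - 1 / ((M : ℝ) + (d + 1 : ℕ)) := by
        push_cast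
        rw [div_sub_div _ _ (by positivity) (by positivity), div_le_div_iff₀ (by positivity) (by positivity)]
        nlinarith [hM0, (Nat.cast_nonneg d : (0 : ℝ) ≤ d)]
      linarith
  refine Real.tsum_le_of_sum_range_le (fun j => by positivity) (fun N => ?_)
  calc _ ≤ ∑ j ∈ Finset.range (M + N), 1 / ((j : ℝ) + 1) ^ 2 :=
        Finset.sum_le_sum_of_subset_of_nonneg (by intro i; simp; omega) (fun _ _ _ => by positivity)
    _ ≤ _ := h N
    _ ≤ _ := by have : 0 ≤ 1 / ((M : ℝ) + N) := by positivity
                linarith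

lemma S_lower (x : ℝ) (hx : 0 < x) (hx1 : x ≤ 1) :
    Zc / x ^ 2 - 5 / 2 / x ≤ ∑' t, ww x t := by
  rw [ww_tsum x hx]
  set M := ⌊1 / x⌋₊ with hMdef
  have h1x : 1 ≤ 1 / x := by rw [le_div_iff₀ hx]; linarith
  have hM1 : 1 ≤ M := Nat.le_floor (by simpa using h1x)
  have hMle : (M : ℝ) ≤ 1 / x := Nat.floor_le (by positivity)
  have hMge : 1 / x < M + 1 := Nat.lt_floor_add_one _
  have hM1' : (1 : ℝ) ≤ M := by exact_mod_cast hM1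
  have hM2 : 1 / (M : ℝ) ≤ 2 * x := by
    rw [div_le_iff₀ (by linarith)]
    rw [div_lt_iff₀ hx] at hMge
    nlinarith
  have ht := Zc_tail M hM1
  have hxM : x * M ≤ 1 := by rw [le_div_iff₀ hx] at hMle; linarith
  have hsum : ∑ j ∈ Finset.range M, (1 / x ^ 2 * (1 / ((j : ℝ) + 1) ^ 2) - 1 / 2) ≤
      ∑' j : ℕ, phi (x * ((j : ℝ) + 1)) := by
    refine (Finset.sum_le_sum (fun j hj => ?_)).trans
      ((phi_summable x hx).sum_le_tsum (Finset.range M) (fun j _ => phi_nonneg _))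
    have hj' : (j : ℝ) + 1 ≤ M := by exact_mod_cast Finset.mem_range.1 hj
    refine le_trans (le_of_eq ?_) (le_phi (x * ((j : ℝ) + 1)) (by positivity) (by nlinarith))
    field_simp
  refine le_trans ?_ hsum
  rw [Finset.sum_sub_distrib, ← Finset.mul_sum]
  simp only [Finset.sum_const, Finset.card_range, nsmul_eq_mul]
  have h5 : 1 / x ^ 2 * (Zc - 2 * x) ≤ 1 / x ^ 2 * ∑ j ∈ Finset.range M, 1 / ((j : ℝ) + 1) ^ 2 :=
    mul_le_mul_of_nonneg_left (by linarith) (by positivity)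
  have h6 : 1 / x ^ 2 * (Zc - 2 * x) = Zc / x ^ 2 - 2 * (1 / x) := by field_simp
  have h7 : 5 / 2 / x = 5 / 2 * (1 / x) := by ring
  rw [h7]
  linarith


noncomputable def ff (m : ℕ) : ℝ := Real.exp (2 * cc * Real.sqrt m) / (m : ℝ) ^ 48

lemma sqrt_one_sub_ge (u : ℝ) (h0 : 0 ≤ u) (h1 : u ≤ 1) :
    1 - u / 2 - u ^ 2 / 2 ≤ Real.sqrt (1 - u) := by
  apply Real.le_sqrt_of_sq_le
  have : (1 - u / 2 - u ^ 2 / 2) ^ 2 = (1 - u) * ((1 - u) * (2 + u) ^ 2 / 4) := by ring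
  rw [this]
  have h2 : (1 - u) * (2 + u) ^ 2 / 4 ≤ 1 := by nlinarith [pow_nonneg h0 3, pow_nonneg h0 2]
  nlinarith

lemma ff_ratio (n z : ℕ) (hz : z < n) :
    ff n * (Real.exp (-(cc / Real.sqrt n * z)) *
      (1 + 48 * (z / n) - cc * Real.sqrt n * (z / n : ℝ) ^ 2)) ≤ ff (n - z) := by
  have hn0 : (0 : ℝ) < n := by exact_mod_cast (by omega : 0 < n)
  have hs : 0 < Real.sqrt n := Real.sqrt_pos.2 hn0
  set u : ℝ := z / n with hu
  have hu0 : 0 ≤ u := by positivity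
  have hu1 : u < 1 := by rw [hu, div_lt_one hn0]; exact_mod_cast hz
  have hm : ((n - z : ℕ) : ℝ) = n * (1 - u) := by
    rw [Nat.cast_sub hz.le, hu]; field_simp
  have h1u : 0 < 1 - u := by linarith
  unfold ff
  rw [hm, Real.sqrt_mul hn0.le, mul_pow]
  have hsq := sqrt_one_sub_ge u hu0 hu1.le
  have hxz : cc / Real.sqrt n * z = cc * Real.sqrt n * u := by
    rw [hu]
    have hss : Real.sqrt n ^ 2 = n := Real.sq_sqrt hn0.le
    field_simp
    rw [hss]
    ring
  rw [hxz]
  have hA : 1 + 48 * u - cc * Real.sqrt n * u ^ 2 ≤ Real.exp (48 * u - cc * Real.sqrt n * u ^ 2) := by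
    have := Real.add_one_le_exp (48 * u - cc * Real.sqrt n * u ^ 2)
    linarith
  have hB : Real.exp (48 * u) * (1 - u) ^ 48 ≤ 1 := by
    have h3 : 1 - u ≤ Real.exp (-u) := by have := Real.add_one_le_exp (-u); linarith
    calc Real.exp (48 * u) * (1 - u) ^ 48 ≤ Real.exp (48 * u) * Real.exp (-u) ^ 48 := by gcongr
      _ = 1 := by rw [← Real.exp_nat_mul, ← Real.exp_add]; norm_num
  have hC : Real.exp (2 * cc * Real.sqrt n) * (Real.exp (-(cc * Real.sqrt n * u)) *
      Real.exp (48 * u - cc * Real.sqrt n * u ^ 2)) ≤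
      Real.exp (48 * u) * Real.exp (2 * cc * (Real.sqrt n * Real.sqrt (1 - u))) := by
    rw [← Real.exp_add, ← Real.exp_add, ← Real.exp_add, Real.exp_le_exp]
    have := mul_le_mul_of_nonneg_left hsq (by have := cc_pos; positivity : 0 ≤ 2 * cc * Real.sqrt n)
    linarith
  rw [le_div_iff₀ (by positivity), div_mul_eq_mul_div, div_mul_eq_mul_div, div_le_iff₀ (by positivity)]
  calc Real.exp (2 * cc * Real.sqrt n) * (Real.exp (-(cc * Real.sqrt n * u)) *
        (1 + 48 * u - cc * Real.sqrt n * u ^ 2)) * ((n : ℝ) ^ 48 * (1 - u) ^ 48)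
      ≤ Real.exp (2 * cc * Real.sqrt n) * (Real.exp (-(cc * Real.sqrt n * u)) *
        Real.exp (48 * u - cc * Real.sqrt n * u ^ 2)) * ((n : ℝ) ^ 48 * (1 - u) ^ 48) := by gcongr
    _ ≤ (Real.exp (48 * u) * Real.exp (2 * cc * (Real.sqrt n * Real.sqrt (1 - u)))) *
          ((n : ℝ) ^ 48 * (1 - u) ^ 48) := by gcongr
    _ = (Real.exp (48 * u) * (1 - u) ^ 48) *
          (Real.exp (2 * cc * (Real.sqrt n * Real.sqrt (1 - u))) * (n : ℝ) ^ 48) := by ring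
    _ ≤ 1 * (Real.exp (2 * cc * (Real.sqrt n * Real.sqrt (1 - u))) * (n : ℝ) ^ 48) := by gcongr
    _ = _ := by ring

/-- termwise lower bound -/
noncomputable def GG (s : ℝ) (t : ℕ × ℕ) : ℝ :=
  ww (cc / s) t + 48 / (cc * s) * (ww (cc / s) t - ww (2 * (cc / s)) t)
    - 8 / (cc * s) * ww (cc / s / 2) t

lemma GG_le (n : ℕ) (hn : 1 ≤ n) (t : ℕ × ℕ) :
    GG (Real.sqrt n) t ≤ ((t.2 : ℝ) + 1) *
      (Real.exp (-(cc / Real.sqrt n * ((t.1 + 1) * (t.2 + 1) : ℕ))) *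
      (1 + 48 * (((t.1 + 1) * (t.2 + 1) : ℕ) / n)
        - cc * Real.sqrt n * (((t.1 + 1) * (t.2 + 1) : ℕ) / n : ℝ) ^ 2)) := by
  have hn0 : (0 : ℝ) < n := by exact_mod_cast hn
  have hs : 0 < Real.sqrt n := Real.sqrt_pos.2 hn0
  have hss : Real.sqrt n ^ 2 = n := Real.sq_sqrt hn0.le
  have hc := cc_pos
  set s := Real.sqrt n with hsdef
  set z : ℝ := (((t.1 + 1) * (t.2 + 1) : ℕ) : ℝ) with hz
  have hz0 : 0 < z := by rw [hz]; positivity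
  have hzz : ((t.1 : ℝ) + 1) * ((t.2 : ℝ) + 1) = z := by rw [hz]; push_cast; ring
  set y := cc / s * z with hy
  have hy0 : 0 < y := by positivity
  have hun : z / n = y / (cc * s) := by rw [hy, ← hss]; field_simp
  unfold GG ww
  rw [hzz, hun]
  have e1 : -(2 * (cc / s) * z) = -y + -y := by rw [hy]; ring
  have e2 : -(cc / s / 2 * z) = -(y / 2) := by rw [hy]; ring
  rw [e1, e2]
  set b := Real.exp (-y) with hb
  have hb0 : 0 < b := Real.exp_pos _
  rw [Real.exp_add]
  -- 1 - b ≤ y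
  have h1 : 1 - b ≤ y := by have := Real.add_one_le_exp (-y); linarith
  -- y^2 b ≤ 8 exp (-y/2)
  have h2 : y ^ 2 * b ≤ 8 * Real.exp (-(y / 2)) := by
    have h3 := Real.quadratic_le_exp_of_nonneg (x := y / 2) (by positivity)
    have h4 : b = Real.exp (-(y / 2)) * Real.exp (-(y / 2)) := by
      rw [hb, ← Real.exp_add]; congr 1; ring
    have h5 : Real.exp (y / 2) * Real.exp (-(y / 2)) = 1 := by rw [← Real.exp_add]; simp
    have h6 := Real.exp_pos (-(y / 2))
    have h7 : y ^ 2 ≤ 8 * Real.exp (y / 2) := by nlinarith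
    calc y ^ 2 * b ≤ 8 * Real.exp (y / 2) * b := by gcongr
      _ = 8 * Real.exp (-(y / 2)) * (Real.exp (y / 2) * Real.exp (-(y / 2))) := by rw [h4]; ring
      _ = _ := by rw [h5, mul_one]
  have h8 : b - b * b ≤ b * y := by nlinarith
  have h9 : 0 < 1 / (cc * s) := by positivity
  have h10 : (0 : ℝ) < (t.2 : ℝ) + 1 := by positivity
  have key : b + 48 / (cc * s) * (b - b * b) - 8 / (cc * s) * Real.exp (-(y / 2)) ≤
      b * (1 + 48 * (y / (cc * s)) - cc * s * (y / (cc * s)) ^ 2) := by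
    have e3 : b * (1 + 48 * (y / (cc * s)) - cc * s * (y / (cc * s)) ^ 2) =
        b + 1 / (cc * s) * (48 * (b * y) - y ^ 2 * b) := by
      field_simp
      ring
    have e4 : b + 48 / (cc * s) * (b - b * b) - 8 / (cc * s) * Real.exp (-(y / 2)) =
        b + 1 / (cc * s) * (48 * (b - b * b) - 8 * Real.exp (-(y / 2))) := by ring
    rw [e3, e4]
    have := mul_le_mul_of_nonneg_left (by linarith : 48 * (b - b * b) - 8 * Real.exp (-(y / 2)) ≤
      48 * (b * y) - y ^ 2 * b) h9.le
    linarith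
  have := mul_le_mul_of_nonneg_left key h10.le
  refine le_trans (le_of_eq ?_) this
  ring

lemma GG_tsum (s : ℝ) (hs : 200 ≤ s) (hs2 : cc ≤ s / 2) :
    Summable (GG s) ∧ s ^ 2 ≤ ∑' t, GG s t := by
  have hc := cc_pos
  have hc1 := one_le_cc
  have hs0 : 0 < s := by linarith
  have hx : 0 < cc / s := by positivity
  have a1 := ww_summable (cc / s) hx
  have a2 := ww_summable (2 * (cc / s)) (by positivity)
  have a3 := ww_summable (cc / s / 2) (by positivity)
  have hS := (a1.hasSum.add ((a1.hasSum.sub a2.hasSum).mul_left (48 / (cc * s)))).sub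
    (a3.hasSum.mul_left (8 / (cc * s)))
  refine ⟨hS.summable, ?_⟩
  have := hS.tsum_eq
  change s ^ 2 ≤ ∑' t, (ww (cc / s) t + 48 / (cc * s) * (ww (cc / s) t - ww (2 * (cc / s)) t)
    - 8 / (cc * s) * ww (cc / s / 2) t)
  rw [this]
  have b1 := S_lower (cc / s) hx (by rw [div_le_one hs0]; linarith)
  have b2 := S_upper (2 * (cc / s)) (by positivity)
  have b3 := S_upper (cc / s / 2) (by positivity)
  rw [← cc_sq] at b1 b2 b3
  have c1 : cc ^ 2 / (cc / s) ^ 2 - 5 / 2 / (cc / s) = s ^ 2 - 5 / 2 * s / cc := by field_simp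
  have c2 : cc ^ 2 / (2 * (cc / s)) ^ 2 = s ^ 2 / 4 := by field_simp; norm_num
  have c3 : cc ^ 2 / (cc / s / 2) ^ 2 = 4 * s ^ 2 := by field_simp; norm_num
  rw [c1] at b1; rw [c2] at b2; rw [c3] at b3
  have k1 : 0 < 48 / (cc * s) := by positivity
  have k2 : 0 < 8 / (cc * s) := by positivity
  have d1 := mul_le_mul_of_nonneg_left (sub_le_sub b1 b2) k1.le
  have d2 := mul_le_mul_of_nonneg_left b3 k2.le
  have d3 : 48 / (cc * s) * (s ^ 2 - 5 / 2 * s / cc - s ^ 2 / 4) = 36 * (s / cc) - 120 / cc ^ 2 := by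
    field_simp; ring
  have d4 : 8 / (cc * s) * (4 * s ^ 2) = 32 * (s / cc) := by field_simp; norm_num
  have d5 : 120 / cc ^ 2 ≤ 3 / 2 * (s / cc) := by
    rw [← sub_nonneg]
    have : 3 / 2 * (s / cc) - 120 / cc ^ 2 = (3 / 2 * s * cc - 120) / cc ^ 2 := by field_simp
    rw [this]
    apply div_nonneg _ (by positivity)
    nlinarith
  have d6 : 5 / 2 * s / cc = 5 / 2 * (s / cc) := by ring
  rw [d3] at d1; rw [d4] at d2; rw [d6] at b1
  linarith

lemma part_lower : ∃ K : ℝ, 0 < K ∧ ∀ n : ℕ, 1 ≤ n →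
    K * ff n ≤ Fintype.card (Nat.Partition n) := by
  classical
  obtain ⟨N0, hN0⟩ : ∃ N0 : ℕ, (200 + 2 * cc + 49) ^ 2 ≤ (N0 : ℝ) := exists_nat_ge _
  have hc := cc_pos
  have hc1 := one_le_cc
  refine ⟨Real.exp (-(2 * cc * Real.sqrt N0)), Real.exp_pos _, ?_⟩
  set K := Real.exp (-(2 * cc * Real.sqrt N0)) with hK
  have hK0 : 0 < K := Real.exp_pos _
  intro n
  induction n using Nat.strong_induction_on with
  | _ n ih =>
  intro hn
  have hn0 : (0 : ℝ) < n := by exact_mod_cast hn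
  have hcard : 0 < Fintype.card (Nat.Partition n) := Fintype.card_pos
  rcases lt_or_ge n N0 with hlt | hge
  · have h1 : ff n ≤ Real.exp (2 * cc * Real.sqrt N0) := by
      unfold ff
      have : (1 : ℝ) ≤ (n : ℝ) ^ 48 := one_le_pow₀ (by exact_mod_cast hn)
      refine (div_le_self (Real.exp_pos _).le this).trans ?_
      rw [Real.exp_le_exp]
      gcongr
    calc K * ff n ≤ K * Real.exp (2 * cc * Real.sqrt N0) := by gcongr
      _ = 1 := by rw [hK, ← Real.exp_add]; simp
      _ ≤ _ := by exact_mod_cast hcard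
  · set s := Real.sqrt n with hs
    have hs1 : 200 + 2 * cc + 49 ≤ s := Real.le_sqrt_of_sq_le (hN0.trans (by exact_mod_cast hge))
    have hss : s ^ 2 = n := Real.sq_sqrt hn0.le
    have hs0 : 0 < s := by linarith
    obtain ⟨hsum, hge2⟩ := GG_tsum s (by linarith) (by linarith)
    set T := (Finset.range n ×ˢ Finset.range n).filter (fun t => (t.1 + 1) * (t.2 + 1) < n) with hT
    have hTmem : ∀ t : ℕ × ℕ, t ∈ T ↔ (t.1 + 1) * (t.2 + 1) < n := by
      intro t
      simp only [hT, Finset.mem_filter, Finset.mem_product, Finset.mem_range, and_iff_right_iff_imp]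
      intro h
      constructor <;> nlinarith
    have hout : ∀ t ∉ T, GG s t ≤ 0 := by
      intro t ht
      rw [hTmem, not_lt] at ht
      refine (GG_le n hn t).trans ?_
      set z : ℝ := (((t.1 + 1) * (t.2 + 1) : ℕ) : ℝ) with hz
      have hzn : (n : ℝ) ≤ z := by rw [hz]; exact_mod_cast ht
      have hu : 1 ≤ z / n := by rwa [le_div_iff₀ hn0, one_mul]
      rw [← hs]
      have h5 : 49 ≤ cc * s := by nlinarith
      have : 1 + 48 * (z / n) - cc * s * (z / n) ^ 2 ≤ 0 := by
        nlinarith [mul_nonneg (sub_nonneg.2 h5) (sq_nonneg (z / n))]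
      apply mul_nonpos_of_nonneg_of_nonpos (by positivity)
      exact mul_nonpos_of_nonneg_of_nonpos (Real.exp_pos _).le this
    have hfin : (n : ℝ) ≤ ∑ t ∈ T, GG s t := by
      have h6 := hsum.neg.sum_le_tsum T (fun t ht => by have := hout t ht; linarith)
      rw [Finset.sum_neg_distrib, tsum_neg] at h6
      rw [← hss]; linarith
    have hE := erdos_ineq n T (fun t ht => ((hTmem t).1 ht).le)
    have hE' : ∑ t ∈ T, ((t.2 : ℝ) + 1) * (Fintype.card (Nat.Partition (n - (t.1 + 1) * (t.2 + 1))) : ℝ) ≤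
      n * Fintype.card (Nat.Partition n) := by exact_mod_cast hE
    have hff0 : 0 < ff n := by unfold ff; positivity
    have h7 : K * ff n * n ≤ n * Fintype.card (Nat.Partition n) := by
      calc K * ff n * n ≤ K * ff n * ∑ t ∈ T, GG s t := by gcongr
        _ = ∑ t ∈ T, K * ff n * GG s t := by rw [Finset.mul_sum]
        _ ≤ _ := by
          refine (Finset.sum_le_sum (fun t ht => ?_)).trans hE'
          have hlt := (hTmem t).1 ht
          have i1 := ih (n - (t.1 + 1) * (t.2 + 1)) (by have : 0 < (t.1 + 1) * (t.2 + 1) := by positivity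
                                                        omega) (by omega)
          have i2 := ff_ratio n _ hlt
          have i3 := GG_le n hn t
          rw [← hs] at i2 i3
          have aux : ∀ e : ℝ, ff n * e ≤ ff (n - (t.1 + 1) * (t.2 + 1)) →
              GG s t ≤ ((t.2 : ℝ) + 1) * e → K * ff n * GG s t ≤ ((t.2 : ℝ) + 1) *
                (Fintype.card (Nat.Partition (n - (t.1 + 1) * (t.2 + 1))) : ℝ) := by
            intro e j2 j3
            calc K * ff n * GG s t ≤ K * ff n * (((t.2 : ℝ) + 1) * e) := by gcongr
              _ = ((t.2 : ℝ) + 1) * (K * (ff n * e)) := by ring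
              _ ≤ ((t.2 : ℝ) + 1) * (K * ff (n - (t.1 + 1) * (t.2 + 1))) := by gcongr
              _ ≤ _ := by gcongr
          exact aux _ i2 i3
    have h8 : (n : ℝ) * (K * ff n) ≤ n * Fintype.card (Nat.Partition n) := by linarith
    exact le_of_mul_le_mul_left h8 hn0


/-- Weyl denominator -/
noncomputable def vand (n : ℕ) : MvPolynomial (Fin n) ℤ :=
  ∏ i : Fin n, ∏ j ∈ Finset.univ.filter (fun j : Fin n => (i : ℕ) < (j : ℕ)),
        (MvPolynomial.X i - MvPolynomial.X j)

/-- power sums -/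
noncomputable def psm (n : ℕ) (A : Type) [CommRing A] (k : ℕ) : MvPolynomial (Fin n) A :=
  ∑ i : Fin n, MvPolynomial.X i ^ k

lemma vand_eq (n : ℕ) : vand n = (Matrix.vandermonde
    (fun i : Fin n => (-MvPolynomial.X i : MvPolynomial (Fin n) ℤ))).det := by
  rw [Matrix.det_vandermonde, vand]
  refine Finset.prod_congr rfl fun i _ => ?_
  refine Finset.prod_congr ?_ fun j _ => by ring
  ext j; simp

lemma vand_swap (n : ℕ) (a b : Fin n) (hab : a ≠ b) :
    MvPolynomial.rename (Equiv.swap a b) (vand n) = - vand n := by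
  rw [vand_eq]
  have h1 : MvPolynomial.rename (R := ℤ) (Equiv.swap a b) (Matrix.vandermonde
    (fun i : Fin n => (-MvPolynomial.X i : MvPolynomial (Fin n) ℤ))).det =
    ((Matrix.vandermonde (fun i : Fin n => (-MvPolynomial.X i : MvPolynomial (Fin n) ℤ))).submatrix
      (Equiv.swap a b) id).det := by
    rw [AlgHom.map_det]
    congr 1
    ext1 i j
    simp [Matrix.vandermonde]
  rw [h1, Matrix.det_permute, Equiv.Perm.sign_swap hab]
  simp

lemma psm_swap (n k : ℕ) (e : Equiv.Perm (Fin n)) :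
    MvPolynomial.rename e (psm n ℤ k) = psm n ℤ k := by
  simp only [psm, map_sum, map_pow, MvPolynomial.rename_X]
  exact Equiv.sum_comp e (fun i => (MvPolynomial.X i : MvPolynomial (Fin n) ℤ) ^ k)

lemma coeff_alt (n : ℕ) (f : MvPolynomial (Fin n) ℤ) (d : Fin n →₀ ℕ) (a b : Fin n)
    (hf : MvPolynomial.rename (Equiv.swap a b) f = -f) (hd : d a = d b) :
    f.coeff d = 0 := by
  have h1 := MvPolynomial.coeff_rename_mapDomain (Equiv.swap a b) (Equiv.injective _) f d
  have h2 : d.mapDomain (Equiv.swap a b) = d := by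
    ext c
    obtain ⟨c, rfl⟩ := (Equiv.swap a b).surjective c
    rw [Finsupp.mapDomain_apply (Equiv.injective _)]
    rcases eq_or_ne c a with rfl | h
    · simp [hd]
    rcases eq_or_ne c b with rfl | h'
    · simp [hd]
    rw [Equiv.swap_apply_of_ne_of_ne h h']
  rw [h2, hf, MvPolynomial.coeff_neg] at h1
  omega

lemma psm_pow (n p : ℕ) [Fact p.Prime] (k j : ℕ) :
    psm n (ZMod p) (k * p ^ j) = psm n (ZMod p) k ^ (p ^ j) := by
  unfold psm
  rw [sum_pow_char_pow]
  simp [pow_mul]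

lemma mul_pow_inj (p : ℕ) (hp : p.Prime) (m m' j j' : ℕ) (h : ¬ p ∣ m) (h' : ¬ p ∣ m')
    (he : m * p ^ j = m' * p ^ j') : m = m' ∧ j = j' := by
  have hm : m ≠ 0 := by rintro rfl; simp at h
  have hm' : m' ≠ 0 := by rintro rfl; simp at h'
  have hj : j = j' := by
    have h1 := congrArg (fun z => z.factorization p) he
    simpa [Nat.factorization_mul hm (pow_ne_zero _ hp.ne_zero),
      Nat.factorization_mul hm' (pow_ne_zero _ hp.ne_zero), hp.factorization_self,
      Nat.factorization_eq_zero_of_not_dvd h, Nat.factorization_eq_zero_of_not_dvd h'] using h1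
  subst hj
  exact ⟨Nat.eq_of_mul_eq_mul_right (pow_pos hp.pos _) he, rfl⟩

lemma exists_Q (n p : ℕ) [Fact p.Prime] (R : ℕ) (m : Fin R → ℕ) (hm : Function.Injective m)
    (hmp : ∀ r, ¬ p ∣ m r) (J : ℕ) (s : Multiset ℕ)
    (hS : ∀ r, p ^ J ≤ ∑ j ∈ Finset.range J, p ^ j * s.count (m r * p ^ j)) :
    ∃ Q : MvPolynomial (Fin n) ℤ,
      (∀ e : Equiv.Perm (Fin n), MvPolynomial.rename e Q = Q) ∧
      MvPolynomial.map (Int.castRingHom (ZMod p)) (s.map (psm n ℤ)).prod =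
      MvPolynomial.map (Int.castRingHom (ZMod p)) ((∏ r, psm n ℤ (m r * p ^ J)) * Q) := by
  classical
  have hp : p.Prime := Fact.out
  set φ := Int.castRingHom (ZMod p)
  set S : Fin R → ℕ := fun r => ∑ j ∈ Finset.range J, p ^ j * s.count (m r * p ^ j) with hSdef
  set U : Finset ℕ := (Finset.univ ×ˢ Finset.range J).image
    (fun t : Fin R × ℕ => m t.1 * p ^ t.2) with hU
  refine ⟨(∏ r, psm n ℤ (m r) ^ (S r - p ^ J)) * ∏ k ∈ (U ∪ s.toFinset) \ U, psm n ℤ k ^ s.count k,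
    ?_, ?_⟩
  · intro e
    simp only [map_mul, map_prod, map_pow, psm_swap]
  · have hmap : ∀ k, MvPolynomial.map φ (psm n ℤ k) = psm n (ZMod p) k := by
      intro k; simp [psm]
    have h1 : (s.map (psm n ℤ)).prod = ∏ k ∈ U ∪ s.toFinset, psm n ℤ k ^ s.count k := by
      rw [Finset.prod_multiset_map_count]
      apply Finset.prod_subset Finset.subset_union_right
      intro k _ hk
      rw [Multiset.mem_toFinset] at hk
      rw [Multiset.count_eq_zero_of_notMem hk, pow_zero]
    rw [h1, ← Finset.prod_sdiff (Finset.subset_union_left : U ⊆ U ∪ s.toFinset), mul_comm, ← mul_assoc,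
      map_mul, map_mul]
    congr 1
    simp only [map_prod, map_mul, map_pow, hmap]
    rw [hU, Finset.prod_image, Finset.prod_product, ← Finset.prod_mul_distrib]
    · refine Finset.prod_congr rfl fun r _ => ?_
      simp only [psm_pow, ← pow_mul]
      rw [Finset.prod_pow_eq_pow_sum, ← pow_add]
      congr 1
      have := hS r
      simp only [hSdef]
      omega
    · intro t _ t' _ h
      obtain ⟨h2, h3⟩ := mul_pow_inj p hp _ _ _ _ (hmp _) (hmp _) h
      exact Prod.ext (hm h2) h3

lemma exists_shift (n p : ℕ) [Fact p.Prime] (R : ℕ) (m : Fin R → ℕ) (hm : Function.Injective m)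
    (hmp : ∀ r, ¬ p ∣ m r) (J : ℕ) (lam mu : Nat.Partition n)
    (hS : ∀ r, p ^ J ≤ ∑ j ∈ Finset.range J, p ^ j * mu.parts.count (m r * p ^ j))
    (hnd : ¬ (p : ℤ) ∣ charSn n lam mu) :
    ∃ i : Fin R → Fin n, ∃ β : Fin n → ℕ, Function.Injective β ∧ ∀ k : Fin n,
      ((lam.parts.sort (· ≤ ·)).reverse.getD k 0) + (n - 1 - (k : ℕ)) =
        β k + ∑ r, if i r = k then m r * p ^ J else 0 := by
  classical
  obtain ⟨Q, hQ, hmap⟩ := exists_Q n p R m hm hmp J mu.parts hS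
  set d : Fin n →₀ ℕ := (Finsupp.equivFunOnFinite.symm fun i : Fin n =>
      ((lam.parts.sort (· ≤ ·)).reverse.getD i 0) + (n - 1 - (i : ℕ))) with hd
  have hc : charSn n lam mu = (vand n * (mu.parts.map (psm n ℤ)).prod).coeff d := rfl
  have h1 : ((charSn n lam mu : ℤ) : ZMod p) =
      (((vand n * ((∏ r, psm n ℤ (m r * p ^ J)) * Q)).coeff d : ℤ) : ZMod p) := by
    rw [hc]
    have e1 : ∀ f : MvPolynomial (Fin n) ℤ, ((f.coeff d : ℤ) : ZMod p) =
        (MvPolynomial.map (Int.castRingHom (ZMod p)) f).coeff d := by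
      intro f; rw [MvPolynomial.coeff_map]; rfl
    rw [e1, e1, map_mul, hmap, ← map_mul]
  have h2 : (vand n * ((∏ r, psm n ℤ (m r * p ^ J)) * Q)).coeff d ≠ 0 := by
    intro h
    rw [h, Int.cast_zero, ZMod.intCast_zmod_eq_zero_iff_dvd] at h1
    exact hnd h1
  have h3 : vand n * ((∏ r, psm n ℤ (m r * p ^ J)) * Q) =
      ∑ i : Fin R → Fin n, MvPolynomial.monomial (∑ r, Finsupp.single (i r) (m r * p ^ J)) 1 *
        (vand n * Q) := by
    rw [← Finset.sum_mul]
    have : (∏ r, psm n ℤ (m r * p ^ J)) = ∑ i : Fin R → Fin n,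
        MvPolynomial.monomial (∑ r, Finsupp.single (i r) (m r * p ^ J)) 1 := by
      unfold psm
      rw [Finset.prod_univ_sum, Fintype.piFinset_univ]
      refine Finset.sum_congr rfl fun i _ => ?_
      rw [MvPolynomial.monomial_sum_one]
      refine Finset.prod_congr rfl fun r _ => ?_
      rw [MvPolynomial.X_pow_eq_monomial]
    rw [this]; ring
  rw [h3, MvPolynomial.coeff_sum] at h2
  obtain ⟨i, -, hi⟩ := Finset.exists_ne_zero_of_sum_ne_zero h2
  rw [MvPolynomial.coeff_monomial_mul'] at hi
  set T := ∑ r, Finsupp.single (i r) (m r * p ^ J) with hT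
  have hle : T ≤ d := by by_contra h; simp [h] at hi
  rw [if_pos hle, one_mul] at hi
  refine ⟨i, fun k => (d - T) k, ?_, ?_⟩
  · intro a b hab
    by_contra hne
    apply hi
    refine coeff_alt n _ _ a b ?_ hab
    rw [map_mul, vand_swap n a b hne, hQ, neg_mul]
  · intro k
    have h5 : d k = (d - T) k + T k := by
      rw [← Finsupp.add_apply, tsub_add_cancel_of_le hle]
    have h6 : T k = ∑ r, if i r = k then m r * p ^ J else 0 := by
      rw [hT, Finsupp.finsetSum_apply]
      refine Finset.sum_congr rfl fun r _ => ?_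
      rw [Finsupp.single_apply]
    rw [← h6, ← h5]
    rfl


/-- sorted parts, padded by zero -/
noncomputable def gam {n : ℕ} (lam : Nat.Partition n) (k : ℕ) : ℕ :=
  (lam.parts.sort (· ≤ ·)).reverse.getD k 0

lemma list_getD_inj (l l' : List ℕ) (h : ∀ x ∈ l, 0 < x) (h' : ∀ x ∈ l', 0 < x)
    (he : ∀ k, l.getD k 0 = l'.getD k 0) : l = l' := by
  induction l generalizing l' with
  | nil =>
    cases l' with
    | nil => rfl
    | cons b l' =>
      have := he 0
      have h2 := h' b (by simp)
      simp at this
      omega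
  | cons a l ih =>
    cases l' with
    | nil =>
      have := he 0
      have h2 := h a (by simp)
      simp at this
      omega
    | cons b l' =>
      have h0 := he 0
      simp at h0
      rw [h0, ih l' (fun x hx => h x (by simp [hx])) (fun x hx => h' x (by simp [hx]))
        (fun k => by simpa using he (k + 1))]

lemma gam_zero {n : ℕ} (lam : Nat.Partition n) (k : ℕ) (hk : lam.parts.card ≤ k) : gam lam k = 0 := by
  unfold gam
  rw [List.getD_eq_default]
  simpa using hk

lemma card_parts_le {n : ℕ} (lam : Nat.Partition n) : lam.parts.card ≤ n := by
  have h := Multiset.card_nsmul_le_sum (s := lam.parts) (a := 1) (fun x hx => lam.parts_pos hx)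
  rw [lam.parts_sum] at h
  simpa using h

lemma gam_anti {n : ℕ} (lam : Nat.Partition n) : Antitone (gam lam) := by
  intro i j hij
  unfold gam
  rcases lt_or_ge j (lam.parts.sort (· ≤ ·)).reverse.length with h | h
  · rw [List.getD_eq_getElem _ _ h, List.getD_eq_getElem _ _ (lt_of_le_of_lt hij h)]
    rcases hij.eq_or_lt with rfl | hlt
    · rfl
    · have hs := Multiset.pairwise_sort lam.parts (· ≤ ·)
      have hs2 : (lam.parts.sort (· ≤ ·)).reverse.Pairwise (fun a b => b ≤ a) := by
        rw [List.pairwise_reverse]; exact hs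
      exact (List.pairwise_iff_getElem.1 hs2) i j _ h hlt
  · rw [List.getD_eq_default _ _ h]
    exact Nat.zero_le _

lemma gam_inj {n : ℕ} (lam lam' : Nat.Partition n) (h : ∀ k, gam lam k = gam lam' k) : lam = lam' := by
  have := list_getD_inj (lam.parts.sort (· ≤ ·)).reverse (lam'.parts.sort (· ≤ ·)).reverse
    (fun x hx => lam.parts_pos (by simpa using hx)) (fun x hx => lam'.parts_pos (by simpa using hx)) h
  have h2 := List.reverse_injective this
  apply Nat.Partition.ext
  rw [← Multiset.sort_eq lam.parts (· ≤ ·), h2, Multiset.sort_eq]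

lemma list_sum_getD (l : List ℕ) (n : ℕ) (h : l.length ≤ n) :
    ∑ k : Fin n, l.getD k 0 = l.sum := by
  rw [Fin.sum_univ_eq_sum_range (fun k => l.getD k 0) n]
  induction l generalizing n with
  | nil => simp
  | cons a l ih =>
    obtain ⟨n, rfl⟩ : ∃ m, n = m + 1 := ⟨n - 1, by simp at h; omega⟩
    rw [Finset.sum_range_succ']
    simp only [List.getD_cons_succ, List.getD_cons_zero, List.sum_cons]
    rw [ih n (by simpa using h), add_comm]

lemma gam_sum {n : ℕ} (lam : Nat.Partition n) : ∑ k : Fin n, gam lam k = n := by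
  unfold gam
  rw [list_sum_getD _ _ (by simpa using card_parts_le lam), List.sum_reverse, ← Multiset.sum_coe,
    Multiset.sort_eq, lam.parts_sum]

lemma mset_eq_of_filter (s s' : Multiset ℕ) (hc : s.card = s'.card)
    (h : s.filter (· ≠ 0) = s'.filter (· ≠ 0)) : s = s' := by
  have h1 := Multiset.filter_add_not (fun x : ℕ => x ≠ 0) s
  have h1' := Multiset.filter_add_not (fun x : ℕ => x ≠ 0) s'
  simp only [not_not, Multiset.filter_eq'] at h1 h1'
  have c1 := congrArg Multiset.card h1
  have c1' := congrArg Multiset.card h1'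
  simp only [Multiset.card_add, Multiset.card_replicate, h] at c1 c1'
  rw [← h1, ← h1', h]
  congr 2
  omega

lemma mono_inj (n : ℕ) (f g : Fin n → ℕ) (hf : Monotone f) (hg : Monotone g)
    (h : (Finset.univ.val.map f).filter (· ≠ 0) = (Finset.univ.val.map g).filter (· ≠ 0)) : f = g := by
  have h1 := mset_eq_of_filter _ _ (by simp) h
  have e : ∀ f : Fin n → ℕ, Finset.univ.val.map f = (List.ofFn f : Multiset ℕ) := by
    intro f
    rw [List.ofFn_eq_map]; rfl
  rw [e, e, Multiset.coe_eq_coe] at h1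
  have hp : ∀ f : Fin n → ℕ, Monotone f → (List.ofFn f).Pairwise (· ≤ ·) := by
    intro f hf
    rw [List.pairwise_ofFn]
    intro i j hij
    exact hf hij.le
  have h2 := List.Perm.eq_of_pairwise (fun a b _ _ h h' => le_antisymm h h') (hp f hf) (hp g hg) h1
  exact List.ofFn_injective h2

lemma exists_part (N : ℕ) (s : Multiset ℕ) (h : s.sum = N) : ∃ π : Nat.Partition N,
    π.parts = s.filter (· ≠ 0) := ⟨Nat.Partition.ofSums N s h, rfl⟩

lemma card_exact_rows (n l : ℕ) (E : Finset (Nat.Partition n)) (hE : ∀ lam ∈ E, lam.parts.card = l) :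
    E.card ≤ Fintype.card (Nat.Partition (n - l)) := by
  classical
  have hex : ∀ lam : Nat.Partition n, ∃ π : Nat.Partition (n - l), lam.parts.card = l →
      π.parts = (lam.parts.map (fun x => x - 1)).filter (· ≠ 0) := by
    intro lam
    by_cases hl : lam.parts.card = l
    · obtain ⟨π, hπ⟩ := exists_part (n - l) (lam.parts.map (fun x => x - 1)) (by
        have h1 : (lam.parts.map (fun x => x - 1 + 1)).sum = n := by
          rw [Multiset.map_congr rfl (g := id) (fun x hx => by
            have := lam.parts_pos hx; simp; omega), Multiset.map_id, lam.parts_sum]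
        rw [Multiset.sum_map_add] at h1
        simp [hl] at h1
        omega)
      exact ⟨π, fun _ => hπ⟩
    · exact ⟨default, fun h => absurd h hl⟩
  choose g hg using hex
  rw [← Finset.card_univ]
  refine Finset.card_le_card_of_injOn g (fun _ _ => Finset.mem_coe.2 (Finset.mem_univ _)) ?_
  intro a ha b hb hab
  have h1 := hg a (hE a ha)
  rw [hab, hg b (hE b hb)] at h1
  have h2 := mset_eq_of_filter _ _ (by simp [hE a ha, hE b hb]) h1
  have h3 := congrArg (Multiset.map (fun x => x + 1)) h2
  simp only [Multiset.map_map] at h3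
  have e : ∀ c : Nat.Partition n, Multiset.map ((fun x => x + 1) ∘ fun x => x - 1) c.parts = c.parts := by
    intro c
    rw [Multiset.map_congr rfl (g := id) (fun x hx => by
            have := c.parts_pos hx; simp; omega), Multiset.map_id]
  rw [e, e] at h3
  exact (Nat.Partition.ext h3).symm

lemma bottom_beads (n L : ℕ) (β : Fin n → ℕ) (hβ : Function.Injective β)
    (hle : ∀ k : Fin n, L ≤ (k : ℕ) → β k ≤ n - 1 - k) :
    ∀ v : ℕ, ∀ k : Fin n, L ≤ (k : ℕ) → (k : ℕ) + v + 1 = n → β k = v := by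
  intro v
  induction v using Nat.strong_induction_on with
  | _ v ih =>
  intro k hk hkv
  have h1 := hle k hk
  by_contra hne
  have hlt : β k < v := by omega
  have h2 := ih (β k) hlt ⟨n - 1 - β k, by omega⟩ (by simp; omega) (by simp; omega)
  have h3 := hβ h2
  have := congrArg Fin.val h3
  simp at this
  omega

/-- shift relation -/
def ShiftRel (n R : ℕ) (t : Fin R → ℕ) (lam : Nat.Partition n) : Prop :=
  ∃ i : Fin R → Fin n, ∃ β : Fin n → ℕ, Function.Injective β ∧ ∀ k : Fin n,
      gam lam k + (n - 1 - (k : ℕ)) = β k + ∑ r, if i r = k then t r else 0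

lemma sum_rev (n : ℕ) : ∑ k : Fin n, (n - 1 - (k : ℕ)) = ∑ k : Fin n, (k : ℕ) := by
  rw [← Equiv.sum_comp Fin.revPerm]
  refine Finset.sum_congr rfl fun k _ => ?_
  simp [Fin.val_rev]; omega

lemma gk_mono (n : ℕ) (g : Fin n → ℕ) (hgm : StrictMono g) :
    (∀ k : Fin n, (k : ℕ) ≤ g k) ∧ Monotone (fun k : Fin n => g k - k) := by
  have key : ∀ d : ℕ, ∀ a b : Fin n, (a : ℕ) + d = b → g a + d ≤ g b := by
    intro d
    induction d with
    | zero =>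
      intro a b hab
      have : a = b := Fin.ext (by simpa using hab)
      rw [this]; simp
    | succ d ih =>
      intro a b hab
      have h1 := ih a ⟨a + d, by omega⟩ rfl
      have h2 : g ⟨a + d, by omega⟩ < g b := hgm (by rw [Fin.lt_def]; simp; omega)
      omega
  have hk_le : ∀ k : Fin n, (k : ℕ) ≤ g k := by
    intro k
    have := key k ⟨0, k.pos⟩ k (by simp)
    omega
  refine ⟨hk_le, ?_⟩
  intro a b hab
  have h1 := key ((b : ℕ) - a) a b (by rw [Fin.le_def] at hab; omega)
  rw [Fin.le_def] at hab
  simp only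
  have := hk_le a
  omega

lemma shift_data (n L R : ℕ) (t : Fin R → ℕ) (ht : ∀ r, 0 < t r) (lam : Nat.Partition n)
    (hL : lam.parts.card ≤ L) (h : ShiftRel n R t lam) :
    (∑ r, t r ≤ n) ∧ ∃ f : Fin R → Fin L, ∃ π : Nat.Partition (n - ∑ r, t r), ∃ g : Fin n → ℕ,
      StrictMono g ∧ π.parts = (Finset.univ.val.map (fun k : Fin n => g k - k)).filter (· ≠ 0) ∧
      Set.range (fun k : Fin n => gam lam k + (n - 1 - (k : ℕ))) =
      Set.range (fun k : Fin n => g k + ∑ r, if (f r : ℕ) + k + 1 = n then t r else 0) := by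
  classical
  obtain ⟨i, β, hβ, he⟩ := h
  have hle : ∀ k : Fin n, L ≤ (k : ℕ) → β k ≤ n - 1 - k := by
    intro k hk
    have h1 := he k
    rw [gam_zero lam k (hL.trans hk)] at h1
    omega
  have hbot := bottom_beads n L β hβ hle
  have hi : ∀ r, (i r : ℕ) < L := by
    intro r
    by_contra hcon
    have h1 := hbot (n - 1 - i r) (i r) (by omega) (by omega)
    have h2 := he (i r)
    rw [gam_zero lam _ (hL.trans (by omega)), h1] at h2
    have h3 : t r ≤ ∑ r', if i r' = i r then t r' else 0 := by
      have := Finset.single_le_sum (f := fun r' => if i r' = i r then t r' else 0)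
        (fun _ _ => Nat.zero_le _) (Finset.mem_univ r)
      simpa using this
    have := ht r
    omega
  -- the sorted version of β
  set B : Finset ℕ := Finset.univ.image β with hB
  have hBc : B.card = n := by
    rw [hB, Finset.card_image_of_injective _ hβ]; simp
  set g : Fin n → ℕ := fun k => B.orderEmbOfFin hBc k with hg
  have hgm : StrictMono g := (B.orderEmbOfFin hBc).strictMono
  have hgr : Set.range g = Set.range β := by
    have := Finset.range_orderEmbOfFin B hBc
    refine this.trans ?_
    rw [hB, Finset.coe_image, Finset.coe_univ, Set.image_univ]
  have hex : ∀ k, ∃ j, g j = β k := by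
    intro k
    have : β k ∈ Set.range g := by rw [hgr]; exact ⟨k, rfl⟩
    exact this
  choose w hw using hex
  have hwinj : Function.Injective w := by
    intro a b hab
    apply hβ
    rw [← hw, ← hw, hab]
  have hwbij : Function.Bijective w := Finite.injective_iff_bijective.1 hwinj
  have hk_le := (gk_mono n g hgm).1
  have hgmono := (gk_mono n g hgm).2
  have hsum1 : ∑ k, g k = ∑ k, β k := by
    have : ∑ k, g (w k) = ∑ k, g k := hwbij.sum_comp g
    rw [← this]; simp [hw]
  have hsum2 : n + ∑ k : Fin n, (k : ℕ) = ∑ k, β k + ∑ r, t r := by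
    have h1 := Finset.sum_congr (rfl : (Finset.univ : Finset (Fin n)) = Finset.univ) (fun k _ => he k)
    rw [Finset.sum_add_distrib, Finset.sum_add_distrib, gam_sum, sum_rev, Finset.sum_comm] at h1
    simpa using h1
  have hsum3 : ∑ k : Fin n, (g k - k) + ∑ k : Fin n, (k : ℕ) = ∑ k, g k := by
    rw [← Finset.sum_add_distrib]
    exact Finset.sum_congr rfl fun k _ => Nat.sub_add_cancel (hk_le k)
  refine ⟨by omega, ?_⟩
  have hn : ∀ r, n - 1 - (w (i r) : ℕ) < L := by
    intro r
    -- all indices above w (i r) come from k < L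
    by_contra hcon
    have hcard : ((Finset.univ : Finset (Fin n)).filter (fun j => w (i r) ≤ j)).card ≤
        ((Finset.range L).card) := by
      have hinv : ∀ j, ∃ k, w k = j := hwbij.surjective
      choose v hv using hinv
      refine Finset.card_le_card_of_injOn (fun j => ((v j : Fin n) : ℕ)) ?_ ?_
      · intro j hj
        simp only [Finset.coe_filter, Finset.mem_univ, true_and, Set.mem_ofPred_eq] at hj
        simp only [Finset.coe_range, Set.mem_Iio]
        by_contra hc
        have h1 := hbot (n - 1 - v j) (v j) (by omega) (by omega)
        have h2 : β (i r) ≤ β (v j) := by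
          rw [← hw, ← hw, hv]
          exact hgm.monotone hj
        have h4 := hi r
        have h3 := hbot (β (i r)) ⟨n - 1 - β (i r), by omega⟩ (by simp; omega) (by simp; omega)
        have h5 := congrArg Fin.val (hβ h3)
        simp at h5
        omega
      · intro a _ b _ hab
        have := Fin.ext hab
        rw [← hv a, ← hv b, this]
    have h6 : (Finset.univ : Finset (Fin n)).filter (fun j => w (i r) ≤ j) = Finset.Ici (w (i r)) := by
      ext; simp
    rw [h6, Fin.card_Ici] at hcard
    simp at hcard
    omega
  obtain ⟨π, hπ⟩ := exists_part (n - ∑ r, t r) (Finset.univ.val.map (fun k : Fin n => g k - k)) (by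
    change ∑ k : Fin n, (g k - k) = _
    omega)
  refine ⟨fun r => ⟨n - 1 - w (i r), hn r⟩, π, g, hgm, hπ, ?_⟩
  refine Eq.trans ?_ (hwbij.surjective.range_comp _)
  congr 1
  funext k
  simp only [Function.comp]
  rw [he k, hw]
  congr 1
  refine Finset.sum_congr rfl fun r _ => ?_
  have : (i r = k) ↔ (n - 1 - (w (i r) : ℕ) + (w k : ℕ) + 1 = n) := by
    rw [← hwinj.eq_iff (a := i r), Fin.ext_iff]
    omega
  simp only [this]

lemma card_shift (n L R : ℕ) (t : Fin R → ℕ) (ht : ∀ r, 0 < t r) (E : Finset (Nat.Partition n))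
    (hL : ∀ lam ∈ E, lam.parts.card ≤ L) (h : ∀ lam ∈ E, ShiftRel n R t lam) :
    E.card ≤ L ^ R * Fintype.card (Nat.Partition (n - ∑ r, t r)) := by
  classical
  have hex : ∀ lam : E, ∃ q : (Fin R → Fin L) × Nat.Partition (n - ∑ r, t r), ∃ g : Fin n → ℕ,
      StrictMono g ∧ q.2.parts = (Finset.univ.val.map (fun k : Fin n => g k - k)).filter (· ≠ 0) ∧
      Set.range (fun k : Fin n => gam lam.1 k + (n - 1 - (k : ℕ))) =
      Set.range (fun k : Fin n => g k + ∑ r, if (q.1 r : ℕ) + k + 1 = n then t r else 0) := by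
    intro lam
    obtain ⟨f, π, h1⟩ := (shift_data n L R t ht lam.1 (hL _ lam.2) (h _ lam.2)).2
    exact ⟨(f, π), h1⟩
  choose q g hg hq hr using hex
  have hinj : Function.Injective q := by
    intro a b hab
    have h1 := hq a
    rw [hab, hq b] at h1
    have h2 := mono_inj n _ _ (gk_mono n _ (hg b)).2 (gk_mono n _ (hg a)).2 h1
    have h3 : g b = g a := by
      funext k
      have := congrFun h2 k
      have i1 := (gk_mono n _ (hg b)).1 k
      have i2 := (gk_mono n _ (hg a)).1 k
      omega
    have h4 := hr a
    rw [hab, ← h3, ← hr b] at h4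
    have hsm : ∀ lam : Nat.Partition n, StrictMono (fun k : Fin n =>
        gam lam (Fin.rev k) + (n - 1 - ((Fin.rev k : Fin n) : ℕ))) := by
      intro lam i j hij
      have := gam_anti lam (Fin.rev_le_rev.2 hij.le)
      rw [Fin.lt_def] at hij
      simp only [Fin.val_rev] at *
      have := i.2
      have := j.2
      omega
    have hrr : ∀ lam : Nat.Partition n, Set.range (fun k : Fin n =>
        gam lam (Fin.rev k) + (n - 1 - ((Fin.rev k : Fin n) : ℕ))) =
        Set.range (fun k : Fin n => gam lam k + (n - 1 - (k : ℕ))) := by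
      intro lam
      exact Fin.rev_surjective.range_comp (fun k : Fin n => gam lam k + (n - 1 - (k : ℕ)))
    rw [← hrr, ← hrr] at h4
    have h5 := (StrictMono.range_inj (hsm a) (hsm b)).1 h4
    apply Subtype.ext
    apply gam_inj
    intro k
    rcases lt_or_ge k n with hk | hk
    · have := congrFun h5 (Fin.rev ⟨k, hk⟩)
      simpa using this
    · rw [gam_zero _ _ ((card_parts_le _).trans hk), gam_zero _ _ ((card_parts_le _).trans hk)]
  have := Fintype.card_le_of_injective q hinj
  simpa using this


/-- the thresholds -/
noncomputable def BB (p I J i : ℕ) : ℕ := ⌈(p : ℝ) ^ (J - 2 * i - 1) / I⌉₊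

/-- the good event for the class of `m` -/
def Good (p I J m : ℕ) (f : ℕ → ℕ) : Prop :=
  ∀ i ∈ Finset.range I, p * BB p I J i ≤ f (m * p ^ (2 * i)) + p * f (m * p ^ (2 * i) * p)

lemma good_sum (p I J m : ℕ) (hI : 1 ≤ I) (hJ : 2 * I ≤ J) (f : ℕ → ℕ)
    (h : Good p I J m f) : p ^ J ≤ ∑ j ∈ Finset.range J, p ^ j * f (m * p ^ j) := by
  have h1 : ∀ K, K ≤ I → ∑ i ∈ Finset.range K, p ^ (2 * i) * (p * BB p I J i) ≤
      ∑ j ∈ Finset.range (2 * K), p ^ j * f (m * p ^ j) := by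
    intro K
    induction K with
    | zero => simp
    | succ K ih =>
      intro hK
      have := ih (by omega)
      rw [Finset.sum_range_succ, show 2 * (K + 1) = 2 * K + 1 + 1 by ring, Finset.sum_range_succ,
        Finset.sum_range_succ]
      have h2 := Nat.mul_le_mul_left (p ^ (2 * K)) (h K (Finset.mem_range.2 (by omega)))
      have h3 : p ^ (2 * K) * (f (m * p ^ (2 * K)) + p * f (m * p ^ (2 * K) * p)) =
          p ^ (2 * K) * f (m * p ^ (2 * K)) + p ^ (2 * K + 1) * f (m * p ^ (2 * K + 1)) := by
        rw [pow_succ, ← mul_assoc m]; ring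
      omega
  have h2 : p ^ J ≤ ∑ i ∈ Finset.range I, p ^ (2 * i) * (p * BB p I J i) := by
    have hI0 : (0 : ℝ) < I := by exact_mod_cast hI
    have h3 : ((p ^ J : ℕ) : ℝ) ≤ ((∑ i ∈ Finset.range I, p ^ (2 * i) * (p * BB p I J i) : ℕ) : ℝ) := by
      push_cast
      calc (p : ℝ) ^ J = ∑ i ∈ Finset.range I, (p : ℝ) ^ J / I := by
            rw [Finset.sum_const, Finset.card_range, nsmul_eq_mul]; field_simp
        _ ≤ _ := by
            refine Finset.sum_le_sum fun i hi => ?_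
            rw [Finset.mem_range] at hi
            have h4 : (p : ℝ) ^ (J - 2 * i - 1) / I ≤ BB p I J i := Nat.le_ceil _
            calc (p : ℝ) ^ J / I = p ^ (2 * i) * (p * (p ^ (J - 2 * i - 1) / I)) := by
                  have : (p : ℝ) ^ J = p ^ (2 * i) * (p * p ^ (J - 2 * i - 1)) := by
                    rw [← pow_succ', ← pow_add]; congr 1; omega
                  rw [this]; ring
              _ ≤ _ := by gcongr
    exact_mod_cast h3
  refine h2.trans ((h1 I le_rfl).trans ?_)
  exact Finset.sum_le_sum_of_subset (Finset.range_mono hJ)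

lemma good_dep (p I J m : ℕ) (f f' : ℕ → ℕ)
    (h : ∀ k ∈ (Finset.range (2 * I)).image (fun j => m * p ^ j), f k = f' k)
    (hg : Good p I J m f) : Good p I J m f' := by
  intro i hi
  have h1 := hg i hi
  rw [Finset.mem_range] at hi
  rw [h _ (Finset.mem_image.2 ⟨2 * i, Finset.mem_range.2 (by omega), rfl⟩),
    h _ (Finset.mem_image.2 ⟨2 * i + 1, Finset.mem_range.2 (by omega), by rw [pow_succ, mul_assoc]⟩)] at h1
  exact h1

lemma one_sub_exp_ge (z : ℝ) (h0 : 0 ≤ z) (h1 : z ≤ 1) : z / 2 ≤ 1 - Real.exp (-z) := by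
  have h2 : Real.exp (-z) ≤ 1 / (1 + z) := by
    rw [Real.exp_neg, ← one_div]
    apply one_div_le_one_div_of_le (by linarith)
    linarith [Real.add_one_le_exp z]
  have h3 : 1 / (1 + z) ≤ 1 - z / 2 := by
    rw [div_le_iff₀ (by linarith)]; nlinarith
  linarith

section
variable {Ω : Type} [MeasurableSpace Ω] {P : Measure Ω} [IsProbabilityMeasure P]
  {a : ℕ → Ω → ℕ}

lemma good_prob (x : ℝ) (hx : 0 < x) (ha : ∀ k, Measurable (a k)) (hi : iIndepFun a P)
    (hP : ∀ k, 1 ≤ k → ∀ j, P.real {ω | a k ω = j} =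
      (Real.exp (-x) ^ k) ^ j * (1 - Real.exp (-x) ^ k))
    (p I J m : ℕ) (hp : p.Prime) (hm : ¬ p ∣ m) (hI : 1 ≤ I) (hJ : 2 * I ≤ J)
    (h1 : x * m * p ^ (2 * I) ≤ 1) (h2 : 16 * (p : ℝ) ^ 2 * I ≤ x * m * p ^ J) :
    (2 * (p : ℝ) ^ 2) ^ I * Real.exp (-(x * m * p ^ J)) ≤
      P.real {ω | Good p I J m (fun k => a k ω)} := by
  have hm1 : 1 ≤ m := by
    rcases Nat.eq_zero_or_pos m with rfl | h
    · simp at hm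
    · exact h
  have hI0 : (0 : ℝ) < I := by exact_mod_cast hI
  have hp0 : (0 : ℝ) < p := by exact_mod_cast hp.pos
  have hm0 : (0 : ℝ) < m := by exact_mod_cast hm1
  set D := x * m * p ^ J with hD
  have hD0 : 0 < D := by positivity
  have hind := indep_inter (P := P) ha hi (Finset.range I)
    (fun i => {m * p ^ (2 * i), m * p ^ (2 * i) * p})
    (fun i f => p * BB p I J i ≤ f (m * p ^ (2 * i)) + p * f (m * p ^ (2 * i) * p))
    (by
      intro i _ f f' hff h
      rw [← hff _ (by simp), ← hff _ (by simp)]; exact h)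
    (by
      intro i _ j _ hij
      rw [Finset.disjoint_left]
      intro k hk hk'
      simp only [Finset.mem_insert, Finset.mem_singleton, mul_assoc, ← pow_succ] at hk hk'
      have key : ∀ u v, m * p ^ u = m * p ^ v → u = v := fun u v h =>
        (mul_pow_inj p hp m m u v hm hm h).2
      rcases hk with rfl | rfl <;> rcases hk' with h | h <;> have := key _ _ h <;> omega)
  have e : {ω | Good p I J m (fun k => a k ω)} = {ω | ∀ i ∈ Finset.range I,
    (fun i f => p * BB p I J i ≤ f (m * p ^ (2 * i)) + p * f (m * p ^ (2 * i) * p)) i (fun k => a k ω)} := rfl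
  rw [e, hind]
  have hterm : ∀ i ∈ Finset.range I, D / (2 * I) * Real.exp (-(D / I) - 1) ≤
      P.real {ω | p * BB p I J i ≤ a (m * p ^ (2 * i)) ω + p * a (m * p ^ (2 * i) * p) ω} := by
    intro i hiI
    rw [Finset.mem_range] at hiI
    refine le_trans ?_ (pair_prob ha hi hP (m * p ^ (2 * i)) (Nat.mul_pos hm1 (pow_pos hp.pos _)) p hp.two_le
      (BB p I J i))
    set z : ℝ := x * (m * p ^ (2 * i) * p) with hz
    have hz0 : 0 < z := by positivity
    have hz1 : z ≤ 1 := by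
      refine le_trans ?_ h1
      have : (p : ℝ) ^ (2 * i) * p ≤ p ^ (2 * I) := by
        rw [← pow_succ]
        exact pow_le_pow_right₀ (by exact_mod_cast hp.one_lt.le) (by omega)
      calc z = x * m * (p ^ (2 * i) * p) := by rw [hz]; ring
        _ ≤ _ := by gcongr
    have e1 : Real.exp (-x) ^ (m * p ^ (2 * i) * p) = Real.exp (-z) := by
      rw [← Real.exp_nat_mul]; congr 1; rw [hz]; push_cast; ring
    rw [pow_mul _ (m * p ^ (2 * i) * p), e1, ← Real.exp_nat_mul]
    have hb1 : (p : ℝ) ^ (J - 2 * i - 1) / I ≤ BB p I J i := Nat.le_ceil _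
    have hb2 : (BB p I J i : ℝ) ≤ (p : ℝ) ^ (J - 2 * i - 1) / I + 1 :=
      (Nat.ceil_lt_add_one (by positivity)).le
    have hDz : (p : ℝ) ^ (J - 2 * i - 1) / I * z = D / I := by
      have : (p : ℝ) ^ J = p ^ (2 * i) * (p * p ^ (J - 2 * i - 1)) := by
        rw [← pow_succ', ← pow_add]; congr 1; omega
      rw [hD, hz, this]; ring
    have hc1 : D / I ≤ BB p I J i * z := by rw [← hDz]; gcongr
    have hc2 : BB p I J i * z ≤ D / I + 1 := by
      have := mul_le_mul_of_nonneg_right hb2 hz0.le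
      rw [add_mul, hDz] at this; linarith
    have hc3 := one_sub_exp_ge z hz0.le hz1
    calc D / (2 * I) * Real.exp (-(D / I) - 1)
        = (D / I) / 2 * Real.exp (-(D / I) - 1) := by ring
      _ ≤ (BB p I J i * z) / 2 * Real.exp (BB p I J i * -z) := by
          gcongr
          linarith
      _ = BB p I J i * (z / 2) * Real.exp (BB p I J i * -z) := by ring
      _ ≤ _ := by gcongr
  refine le_trans ?_ (Finset.prod_le_prod (fun _ _ => by positivity) hterm)
  rw [Finset.prod_const, Finset.card_range]
  have e2 : D / (2 * I) * Real.exp (-(D / I) - 1) = (D / (2 * I) * Real.exp (-1)) * Real.exp (-(D / I)) := by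
    rw [sub_eq_add_neg, Real.exp_add]; ring
  have e3 : Real.exp (-(D / I)) ^ I = Real.exp (-D) := by
    rw [← Real.exp_nat_mul]; congr 1; field_simp
  rw [e2, mul_pow (D / (2 * I) * Real.exp (-1)), e3]
  refine mul_le_mul_of_nonneg_right (pow_le_pow_left₀ (by positivity) ?_ _) (Real.exp_pos _).le
  have h5 : (1 : ℝ) / 4 ≤ Real.exp (-1) := by
    rw [Real.exp_neg, ← one_div]
    apply one_div_le_one_div_of_le (Real.exp_pos _)
    linarith [Real.exp_one_lt_d9]
  have h6 : 8 * (p : ℝ) ^ 2 ≤ D / (2 * I) := by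
    rw [le_div_iff₀ (by positivity)]; linarith
  nlinarith [mul_le_mul h6 h5 (by norm_num) (by positivity)]

lemma group_prob (x : ℝ) (hx : 0 < x) (ha : ∀ k, Measurable (a k)) (hi : iIndepFun a P)
    (hP : ∀ k, 1 ≤ k → ∀ j, P.real {ω | a k ω = j} =
      (Real.exp (-x) ^ k) ^ j * (1 - Real.exp (-x) ^ k))
    (p I J : ℕ) (hp : p.Prime) (hI : 1 ≤ I) (hJ : 2 * I ≤ J) (G : Finset ℕ) (ρ : ℝ)
    (hm : ∀ m ∈ G, ¬ p ∣ m)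
    (h1 : ∀ m ∈ G, x * m * p ^ (2 * I) ≤ 1) (h2 : ∀ m ∈ G, 16 * (p : ℝ) ^ 2 * I ≤ x * m * p ^ J)
    (h3 : ∀ m ∈ G, ρ ≤ (2 * (p : ℝ) ^ 2) ^ I * Real.exp (-(x * m * p ^ J))) :
    P.real {ω | ∀ m ∈ G, ¬ Good p I J m (fun k => a k ω)} ≤ Real.exp (-(ρ * G.card)) := by
  have hdep : ∀ m, ∀ f f' : ℕ → ℕ, (∀ k ∈ (Finset.range (2 * I)).image (fun j => m * p ^ j), f k = f' k) →
      ¬ Good p I J m f → ¬ Good p I J m f' := by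
    intro m f f' hf h hg
    exact h (good_dep p I J m f' f (fun k hk => (hf k hk).symm) hg)
  have hind := indep_inter (P := P) ha hi G
    (fun m => (Finset.range (2 * I)).image (fun j => m * p ^ j))
    (fun m f => ¬ Good p I J m f)
    (fun m _ => hdep m)
    (by
      intro m hm1 m' hm2 hne
      rw [Finset.disjoint_left]
      intro k hk hk'
      obtain ⟨j, -, rfl⟩ := Finset.mem_image.1 hk
      obtain ⟨j', -, hj'⟩ := Finset.mem_image.1 hk'
      exact hne (mul_pow_inj p hp _ _ _ _ (hm _ hm2) (hm _ hm1) hj').1.symm)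
  rw [hind]
  have hterm : ∀ m ∈ G, P.real {ω | ¬ Good p I J m (fun k => a k ω)} ≤ Real.exp (-ρ) := by
    intro m hmG
    have hg := good_prob x hx ha hi hP p I J m hp (hm m hmG) hI hJ (h1 m hmG) (h2 m hmG)
    have hms : MeasurableSet {ω | Good p I J m (fun k => a k ω)} :=
      measSet_dep ha _ (Good p I J m) (good_dep p I J m)
    have hcompl : {ω | ¬ Good p I J m (fun k => a k ω)} = {ω | Good p I J m (fun k => a k ω)}ᶜ := rfl
    rw [hcompl, probReal_compl_eq_one_sub hms]
    have := Real.add_one_le_exp (-ρ)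
    linarith [h3 m hmG]
  refine (Finset.prod_le_prod (fun _ _ => measureReal_nonneg) hterm).trans ?_
  rw [Finset.prod_const, ← Real.exp_nat_mul]
  apply le_of_eq
  congr 1; ring

end

lemma bad_mu_card (n : ℕ) (hn : 1 ≤ n) (p I J R : ℕ) (hp : p.Prime) (hI : 1 ≤ I) (hJ : 2 * I ≤ J)
    (G : Fin R → Finset ℕ) (ρ Y : ℝ)
    (hm : ∀ r, ∀ m ∈ G r, ¬ p ∣ m)
    (h1 : ∀ r, ∀ m ∈ G r, cc / Real.sqrt n * m * p ^ (2 * I) ≤ 1)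
    (h2 : ∀ r, ∀ m ∈ G r, 16 * (p : ℝ) ^ 2 * I ≤ cc / Real.sqrt n * m * p ^ J)
    (h3 : ∀ r, ∀ m ∈ G r, ρ ≤ (2 * (p : ℝ) ^ 2) ^ I * Real.exp (-(cc / Real.sqrt n * m * p ^ J)))
    (h4 : ∀ r, Y ≤ ρ * (G r).card)
    (E : Finset (Nat.Partition n))
    (hE : ∀ μ ∈ E, ∃ r, ∀ m ∈ G r,
      ¬ p ^ J ≤ ∑ j ∈ Finset.range J, p ^ j * μ.parts.count (m * p ^ j)) :
    (E.card : ℝ) ≤ R * Real.exp (-Y) * Real.exp (2 * cc * Real.sqrt n) := by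
  have hn0 : (0 : ℝ) < n := by exact_mod_cast hn
  have hs : 0 < Real.sqrt n := Real.sqrt_pos.2 hn0
  have hx : 0 < cc / Real.sqrt n := div_pos cc_pos hs
  have hp0 : (0 : ℝ) < p := by exact_mod_cast hp.pos
  set x := cc / Real.sqrt n with hxdef
  obtain ⟨Ω, mΩ, P, iP, a, ha, hi, hP⟩ := boltz_exists (Real.exp (-x)) (Real.exp_pos _)
    (by rw [Real.exp_lt_one_iff]; linarith)
  have hb := card_le_prob ha hi hP n E (⋃ r, {ω | ∀ m ∈ G r, ¬ Good p I J m (fun k => a k ω)}) (by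
    intro μ hμ ω hω
    obtain ⟨r, hr⟩ := hE μ hμ
    rw [Set.mem_iUnion]
    refine ⟨r, ?_⟩
    intro m hmG hgood
    apply hr m hmG
    apply good_sum p I J m hI hJ (fun k => μ.parts.count k)
    refine good_dep p I J m _ _ ?_ hgood
    intro k hk
    obtain ⟨j, hj, rfl⟩ := Finset.mem_image.1 hk
    rw [Finset.mem_range] at hj
    apply hω
    have hm1 : 1 ≤ m := by
      rcases Nat.eq_zero_or_pos m with rfl | h
      · exact absurd (dvd_zero p) (hm r _ hmG)
      · exact h
    rw [Finset.mem_Icc]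
    refine ⟨Nat.mul_pos hm1 (pow_pos hp.pos _), ?_⟩
    have h5 : (m : ℝ) * p ^ j ≤ m * p ^ (2 * I) := by
      gcongr
      exact_mod_cast hp.one_lt.le
    have h6 := h1 r m hmG
    have h7 : cc * (m * (p : ℝ) ^ (2 * I)) ≤ Real.sqrt n := by
      have : x * m * p ^ (2 * I) = cc * (m * (p : ℝ) ^ (2 * I)) / Real.sqrt n := by
        rw [hxdef]; ring
      rwa [this, div_le_one hs] at h6
    have h8 : (m : ℝ) * p ^ (2 * I) ≤ cc * (m * (p : ℝ) ^ (2 * I)) :=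
      le_mul_of_one_le_left (by positivity) one_le_cc
    have h9 : Real.sqrt n ≤ n := by
      rw [Real.sqrt_le_left hn0.le]
      have : (1 : ℝ) ≤ n := by exact_mod_cast hn
      nlinarith
    have : (m : ℝ) * p ^ j ≤ n := by linarith
    exact_mod_cast this)
  have hu : P.real (⋃ r, {ω | ∀ m ∈ G r, ¬ Good p I J m (fun k => a k ω)}) ≤ R * Real.exp (-Y) := by
    refine (measureReal_iUnion_fintype_le _).trans ?_
    calc ∑ r : Fin R, P.real {ω | ∀ m ∈ G r, ¬ Good p I J m (fun k => a k ω)}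
        ≤ ∑ r : Fin R, Real.exp (-Y) := by
          refine Finset.sum_le_sum fun r _ => ?_
          refine (group_prob x hx ha hi hP p I J hp hI hJ (G r) ρ (hm r) (h1 r) (h2 r) (h3 r)).trans ?_
          rw [Real.exp_le_exp]
          linarith [h4 r]
      _ = _ := by simp
  have hc := boltz_const n hn
  have h10 : (E.card : ℝ) * Real.exp (-(2 * cc * Real.sqrt n)) ≤ R * Real.exp (-Y) :=
    (mul_le_mul_of_nonneg_left hc (by positivity)).trans (hb.trans hu)
  rw [Real.exp_neg, ← div_eq_mul_inv, div_le_iff₀ (Real.exp_pos _)] at h10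
  exact h10


set_option maxHeartbeats 2000000 in
lemma groups_core (p R : ℕ) (hp : p.Prime) (hR : 1 ≤ R) (l x e : ℝ) (he : e = 1 / (256 * (p : ℝ) ^ 2))
    (hx : x = cc * Real.exp (-(l / 2))) (hl : 1 ≤ l) (hl2 : 1 ≤ 8 * e * l)
    (hM : 2 * cc * p * (4 * p * R * (p + 1) / e) ≤ Real.exp (l / 4)) :
    ∃ I J : ℕ, ∃ G : Fin R → Finset ℕ, ∃ ρ : ℝ, 1 ≤ I ∧ 2 * I ≤ J ∧
      (∀ r, ∀ m ∈ G r, ¬ p ∣ m) ∧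
      (∀ r, ∀ m ∈ G r, x * m * p ^ (2 * I) ≤ 1) ∧
      (∀ r, ∀ m ∈ G r, 16 * (p : ℝ) ^ 2 * I ≤ x * m * p ^ J) ∧
      (∀ r, ∀ m ∈ G r, ρ ≤ (2 * (p : ℝ) ^ 2) ^ I * Real.exp (-(x * m * p ^ J))) ∧
      (∀ r, e / (16 * p ^ 2 * R * cc) * Real.exp (2 * e * l) ≤ ρ * (G r).card) ∧
      (∀ r, ∀ m ∈ G r, (1 / 2 + e) * l ≤ x * m * p ^ J) ∧
      (∀ r r', r ≠ r' → Disjoint (G r) (G r')) := by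
  have hc := cc_pos
  have hp2 : (2 : ℝ) ≤ p := by exact_mod_cast hp.two_le
  have hp0 : (0 : ℝ) < p := by linarith
  have hR1 : (1 : ℝ) ≤ R := by exact_mod_cast hR
  have hR0 : (0 : ℝ) < R := by linarith
  have he0 : 0 < e := by rw [he]; positivity
  have hep : e * (p : ℝ) ^ 2 = 1 / 256 := by rw [he]; field_simp
  have he1 : e ≤ 1 / 4 := by nlinarith
  have hx0 : 0 < x := by rw [hx]; positivity
  obtain ⟨k, hk1, hk2⟩ := exists_nat_pow_near hl (by linarith : 1 < (p : ℝ))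
  set I := ⌊8 * e * l⌋₊ with hI
  have hI1 : 1 ≤ I := Nat.le_floor (by simpa using hl2)
  have hIle : (I : ℝ) ≤ 8 * e * l := Nat.floor_le (by positivity)
  have hIgt : 8 * e * l < I + 1 := Nat.lt_floor_add_one _
  set J := 2 * I + (k + 1) with hJ
  have hpJ : (p : ℝ) ^ J = p ^ (2 * I) * p ^ (k + 1) := by rw [hJ, pow_add]
  have hph : (p : ℝ) ^ (k + 1) ≤ p * l := by rw [pow_succ']; gcongr
  set M := (1 / 2 + e) * l / (x * p ^ J) with hMdef
  have hxJ : 0 < x * (p : ℝ) ^ J := by positivity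
  have hM0 : 0 < M := by positivity
  have hMx : x * M * p ^ J = (1 / 2 + e) * l := by rw [hMdef]; field_simp
  have hsl : Real.exp (l / 2) * Real.exp (-(l / 2)) = 1 := by rw [← Real.exp_add]; simp
  have hMlow : Real.exp (l / 2) / (2 * cc * p * p ^ (2 * I)) ≤ M := by
    rw [hMdef, div_le_div_iff₀ (by positivity) hxJ, hpJ, hx]
    calc Real.exp (l / 2) * (cc * Real.exp (-(l / 2)) * (p ^ (2 * I) * p ^ (k + 1)))
        = (Real.exp (l / 2) * Real.exp (-(l / 2))) * (cc * p ^ (2 * I)) * p ^ (k + 1) := by ring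
      _ ≤ (Real.exp (l / 2) * Real.exp (-(l / 2))) * (cc * p ^ (2 * I)) * (p * l) := by gcongr
      _ = (1 / 2) * l * (2 * cc * p * p ^ (2 * I)) := by rw [hsl]; ring
      _ ≤ _ := by gcongr; linarith
  have hpI : (p : ℝ) ^ (2 * I) ≤ Real.exp (l / 4) := by
    have h1 : (p : ℝ) ≤ Real.exp p := by linarith [Real.add_one_le_exp (p : ℝ)]
    calc (p : ℝ) ^ (2 * I) ≤ Real.exp p ^ (2 * I) := by gcongr
      _ = Real.exp ((2 * I : ℕ) * p) := by rw [← Real.exp_nat_mul]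
      _ ≤ _ := by
        rw [Real.exp_le_exp]
        push_cast
        have h2 : 64 * e * p ≤ 1 := by nlinarith
        calc 2 * (I : ℝ) * p ≤ 2 * (8 * e * l) * p := by gcongr
          _ = (64 * e * p) * (l / 4) := by ring
          _ ≤ 1 * (l / 4) := by gcongr
          _ = _ := by ring
  have hMbig : 4 * p * R * (p + 1) / e ≤ M := by
    refine le_trans ?_ hMlow
    rw [le_div_iff₀ (by positivity)]
    have h3 : Real.exp (l / 2) = Real.exp (l / 4) * Real.exp (l / 4) := by
      rw [← Real.exp_add]; congr 1; ring
    rw [h3]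
    calc 4 * p * R * (p + 1) / e * (2 * cc * p * p ^ (2 * I))
        = (2 * cc * p * (4 * p * R * (p + 1) / e)) * p ^ (2 * I) := by ring
      _ ≤ _ := by gcongr
  have heM : 4 * p * R * (p + 1) ≤ e * M := by
    rw [div_le_iff₀ he0] at hMbig; linarith
  set b := ⌈M / p⌉₊ with hb
  have hb1 : M / p ≤ b := Nat.le_ceil _
  have hb2 : (b : ℝ) < M / p + 1 := Nat.ceil_lt_add_one (by positivity)
  set W := ⌊e * M / (2 * p * R)⌋₊ with hW
  have hW1 : (W : ℝ) ≤ e * M / (2 * p * R) := Nat.floor_le (by positivity)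
  have hW2 : e * M / (2 * p * R) < W + 1 := Nat.lt_floor_add_one _
  have hW3 : e * M / (4 * p * R) ≤ W := by
    have h4 : 1 ≤ e * M / (4 * p * R) := by
      rw [le_div_iff₀ (by positivity)]
      have : 0 < 4 * p * R * (p : ℝ) := by positivity
      linarith
    have h5 : e * M / (2 * p * R) = 2 * (e * M / (4 * p * R)) := by field_simp; norm_num
    linarith
  set G : Fin R → Finset ℕ := fun r => (Finset.range W).image (fun s => p * (b + (r * W + s)) + 1) with hG
  have hGb : ∀ r, ∀ m ∈ G r, M ≤ m ∧ (m : ℝ) ≤ (1 + e) * M := by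
    intro r m hm
    obtain ⟨s, hs, rfl⟩ := Finset.mem_image.1 hm
    rw [Finset.mem_range] at hs
    have h6 : (r : ℕ) * W + s ≤ R * W := by
      have : (r : ℕ) + 1 ≤ R := r.2
      calc (r : ℕ) * W + s ≤ (r + 1) * W := by rw [add_mul]; omega
        _ ≤ _ := Nat.mul_le_mul_right _ this
    have h7 : (((r : ℕ) * W + s : ℕ) : ℝ) ≤ R * W := by exact_mod_cast h6
    have h8 : M ≤ p * b := by rw [div_le_iff₀ hp0] at hb1; linarith
    have h9 : (p : ℝ) * b ≤ M + p := by
      have := mul_le_mul_of_nonneg_left hb2.le hp0.le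
      rw [mul_add, mul_div_cancel₀ _ hp0.ne'] at this; linarith
    have h10 : (p : ℝ) * (R * W) ≤ e * M / 2 := by
      have := mul_le_mul_of_nonneg_left hW1 (by positivity : 0 ≤ (p : ℝ) * R)
      calc (p : ℝ) * (R * W) = p * R * W := by ring
        _ ≤ _ := this
        _ = _ := by field_simp
    have h11 : (p : ℝ) + 1 ≤ e * M / 2 := by
      have t1 : (2 : ℝ) * 1 ≤ p * R := mul_le_mul hp2 hR1 zero_le_one hp0.le
      have t2 : 2 ≤ 4 * p * (R : ℝ) := by linarith
      have t3 := mul_le_mul_of_nonneg_right t2 (by linarith : (0 : ℝ) ≤ p + 1)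
      linarith
    have h12 : (0 : ℝ) ≤ (((r : ℕ) * W + s : ℕ) : ℝ) := Nat.cast_nonneg _
    have h13 : (((p * (b + (r * W + s)) + 1 : ℕ)) : ℝ) = p * b + p * (((r : ℕ) * W + s : ℕ) : ℝ) + 1 := by
      push_cast; ring
    rw [h13]
    have h14 := mul_le_mul_of_nonneg_left h7 hp0.le
    constructor
    · have := mul_nonneg hp0.le h12
      linarith
    · linarith
  have hGD : ∀ r, ∀ m ∈ G r, (1 / 2 + e) * l ≤ x * m * p ^ J ∧ x * m * p ^ J ≤ (1 / 2 + 2 * e) * l := by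
    intro r m hm
    obtain ⟨h1, h2⟩ := hGb r m hm
    constructor
    · rw [← hMx]; gcongr
    · calc x * m * p ^ J ≤ x * ((1 + e) * M) * p ^ J := by gcongr
        _ = (1 + e) * (x * M * p ^ J) := by ring
        _ = (1 + e) * (1 / 2 + e) * l := by rw [hMx]; ring
        _ ≤ _ := by gcongr; nlinarith
  refine ⟨I, J, G, (2 * (p : ℝ) ^ 2) ^ I * Real.exp (-((1 / 2 + 2 * e) * l)), hI1, by omega, ?_, ?_, ?_, ?_,
    ?_, fun r m hm => (hGD r m hm).1, ?_⟩
  · intro r m hm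
    obtain ⟨s, hs, rfl⟩ := Finset.mem_image.1 hm
    intro hd
    have := (Nat.dvd_add_right (Dvd.intro _ rfl)).1 hd
    exact hp.one_lt.ne' (Nat.dvd_one.1 this)
  · intro r m hm
    have h1 := (hGD r m hm).2
    rw [hpJ, ← mul_assoc] at h1
    have h2 : (1 / 2 + 2 * e) * l ≤ 1 * p ^ (k + 1) := by nlinarith
    exact le_of_mul_le_mul_right (h1.trans h2) (by positivity)
  · intro r m hm
    have h1 := (hGD r m hm).1
    have h2 : 16 * (p : ℝ) ^ 2 * I ≤ 16 * (p : ℝ) ^ 2 * (8 * e * l) := by gcongr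
    have h3 : 16 * (p : ℝ) ^ 2 * (8 * e * l) = 128 * (e * p ^ 2) * l := by ring
    rw [h3, hep] at h2
    nlinarith
  · intro r m hm
    have h1 := (hGD r m hm).2
    gcongr
  · intro r
    have hcard : (G r).card = W := by
      rw [hG, Finset.card_image_of_injective, Finset.card_range]
      intro s s' h
      simp only [add_left_inj] at h
      have := Nat.eq_of_mul_eq_mul_left hp.pos h
      omega
    rw [hcard]
    have h2I : Real.exp (4 * e * l) ≤ 2 * 2 ^ I := by
      have h1 : Real.exp (1 / 2) ≤ 2 := by
        rw [← Real.le_log_iff_exp_le (by norm_num)]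
        linarith [Real.log_two_gt_d9]
      calc Real.exp (4 * e * l) ≤ Real.exp ((I + 1 : ℕ) * (1 / 2)) := by
            rw [Real.exp_le_exp]; push_cast; linarith
        _ = Real.exp (1 / 2) ^ (I + 1) := by rw [Real.exp_nat_mul]
        _ ≤ 2 ^ (I + 1) := by gcongr
        _ = _ := by rw [pow_succ]; ring
    have e1 : Real.exp (-((1 / 2 + 2 * e) * l)) = Real.exp (-(l / 2)) * Real.exp (-(2 * e * l)) := by
      rw [← Real.exp_add]; congr 1; ring
    have e2 : Real.exp (4 * e * l) * Real.exp (-(2 * e * l)) = Real.exp (2 * e * l) := by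
      rw [← Real.exp_add]; congr 1; ring
    have e3 : (2 * (p : ℝ) ^ 2) ^ I = 2 ^ I * p ^ (2 * I) := by rw [mul_pow, ← pow_mul]
    calc e / (16 * p ^ 2 * R * cc) * Real.exp (2 * e * l)
        = e / (16 * p ^ 2 * R * cc) * (Real.exp (4 * e * l) * Real.exp (-(2 * e * l))) := by rw [e2]
      _ ≤ e / (16 * p ^ 2 * R * cc) * (2 * 2 ^ I * Real.exp (-(2 * e * l))) := by gcongr
      _ = 2 ^ I * Real.exp (-(2 * e * l)) * (e / (8 * p ^ 2 * R * cc)) * 1 := by field_simp; norm_num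
      _ = 2 ^ I * Real.exp (-(2 * e * l)) * (e / (8 * p ^ 2 * R * cc)) *
            (Real.exp (l / 2) * Real.exp (-(l / 2))) := by rw [hsl]
      _ = 2 ^ I * p ^ (2 * I) * (Real.exp (-(l / 2)) * Real.exp (-(2 * e * l))) *
            (e * (Real.exp (l / 2) / (2 * cc * p * p ^ (2 * I))) / (4 * p * R)) := by
            field_simp; norm_num
      _ ≤ 2 ^ I * p ^ (2 * I) * (Real.exp (-(l / 2)) * Real.exp (-(2 * e * l))) *
            (e * M / (4 * p * R)) := by gcongr
      _ ≤ 2 ^ I * p ^ (2 * I) * (Real.exp (-(l / 2)) * Real.exp (-(2 * e * l))) * W := by gcongr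
      _ = _ := by rw [e1, e3]
  · intro r r' hne
    rw [Finset.disjoint_left]
    intro m hm hm'
    obtain ⟨s, hs, rfl⟩ := Finset.mem_image.1 hm
    obtain ⟨s', hs', h⟩ := Finset.mem_image.1 hm'
    rw [Finset.mem_range] at hs hs'
    simp only [add_left_inj] at h
    have h1 := Nat.eq_of_mul_eq_mul_left hp.pos h
    have h2 : (r' : ℕ) * W + s' = r * W + s := by omega
    apply hne
    apply Fin.ext
    have hWpos : 0 < W := by omega
    have h3 := congrArg (· / W) h2
    simp only [mul_comm _ W, Nat.mul_add_div hWpos, Nat.div_eq_of_lt hs, Nat.div_eq_of_lt hs'] at h3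
    omega


lemma part_shift (n T : ℕ) (hn : 1 ≤ n) (hT : T ≤ n) :
    (Fintype.card (Nat.Partition (n - T)) : ℝ) ≤
      Real.exp (2 * cc * Real.sqrt n) * Real.exp (-(cc / Real.sqrt n * T)) := by
  have hn0 : (0 : ℝ) < n := by exact_mod_cast hn
  have hs : 0 < Real.sqrt n := Real.sqrt_pos.2 hn0
  have hss : Real.sqrt n ^ 2 = n := Real.sq_sqrt hn0.le
  have hc := cc_pos
  refine (part_upper _).trans ?_
  rw [← Real.exp_add, Real.exp_le_exp, Nat.cast_sub hT]
  have hT' : (T : ℝ) ≤ n := by exact_mod_cast hT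
  have h1 : Real.sqrt ((n : ℝ) - T) ^ 2 = n - T := Real.sq_sqrt (by linarith)
  have h2 : Real.sqrt ((n : ℝ) - T) ≤ Real.sqrt n - T / (2 * Real.sqrt n) := by
    rw [← sub_nonneg]
    have : Real.sqrt n - T / (2 * Real.sqrt n) - Real.sqrt ((n : ℝ) - T) =
        (Real.sqrt n - Real.sqrt ((n : ℝ) - T)) ^ 2 / (2 * Real.sqrt n) := by
      have h3 : (T : ℝ) = Real.sqrt n ^ 2 - Real.sqrt ((n : ℝ) - T) ^ 2 := by rw [hss, h1]; ring
      rw [eq_div_iff (by positivity), sub_mul, sub_mul, div_mul_cancel₀ _ (by positivity)]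
      nlinarith
    rw [this]; positivity
  have h4 := mul_le_mul_of_nonneg_left h2 (by positivity : 0 ≤ 2 * cc)
  have h5 : 2 * cc * (Real.sqrt n - T / (2 * Real.sqrt n)) =
      2 * cc * Real.sqrt n + -(cc / Real.sqrt n * T) := by field_simp; ring
  linarith

lemma many_rows (n L : ℕ) (hn : 1 ≤ n) (E : Finset (Nat.Partition n)) (hE : ∀ lam ∈ E, L < lam.parts.card) :
    (E.card : ℝ) ≤ n * (Real.exp (2 * cc * Real.sqrt n) * Real.exp (-(cc / Real.sqrt n * L))) := by
  classical
  have hn0 : (0 : ℝ) < n := by exact_mod_cast hn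
  have hs : 0 < Real.sqrt n := Real.sqrt_pos.2 hn0
  have hc := cc_pos
  have h1 : E.card = ∑ l ∈ Finset.Icc 1 n, (E.filter (fun lam => lam.parts.card = l)).card := by
    apply Finset.card_eq_sum_card_fiberwise
    intro lam hlam
    have := hE lam hlam
    exact Finset.mem_coe.2 (Finset.mem_Icc.2 ⟨(Nat.zero_le L).trans_lt this, card_parts_le lam⟩)
  rw [h1, Nat.cast_sum]
  calc ∑ l ∈ Finset.Icc 1 n, ((E.filter (fun lam => lam.parts.card = l)).card : ℝ)
      ≤ ∑ l ∈ Finset.Icc 1 n, (Real.exp (2 * cc * Real.sqrt n) * Real.exp (-(cc / Real.sqrt n * L))) := by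
        refine Finset.sum_le_sum fun l hl => ?_
        rw [Finset.mem_Icc] at hl
        rcases le_or_gt l L with h | h
        · have : E.filter (fun lam => lam.parts.card = l) = ∅ := by
            rw [Finset.filter_eq_empty_iff]
            intro lam hlam
            have := hE lam hlam
            omega
          rw [this]; simp; positivity
        · have h2 := card_exact_rows n l (E.filter (fun lam => lam.parts.card = l))
            (fun lam hlam => (Finset.mem_filter.1 hlam).2)
          have h3 : ((E.filter (fun lam => lam.parts.card = l)).card : ℝ) ≤
            Fintype.card (Nat.Partition (n - l)) := by exact_mod_cast h2
          refine h3.trans ((part_shift n l hn hl.2).trans ?_)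
          gcongr
    _ = _ := by simp

lemma few_rows (n p J L R : ℕ) (hn : 1 ≤ n) (hp : p.Prime) (mu : Nat.Partition n)
    (m : Fin R → ℕ) (hm : Function.Injective m) (hmp : ∀ r, ¬ p ∣ m r) (u : ℝ)
    (hu : ∀ r, u ≤ cc / Real.sqrt n * m r * p ^ J)
    (hS : ∀ r, p ^ J ≤ ∑ j ∈ Finset.range J, p ^ j * mu.parts.count (m r * p ^ j))
    (E : Finset (Nat.Partition n))
    (hE : ∀ lam ∈ E, lam.parts.card ≤ L ∧ ¬ (p : ℤ) ∣ charSn n lam mu) :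
    (E.card : ℝ) ≤ (L : ℝ) ^ R * (Real.exp (2 * cc * Real.sqrt n) * Real.exp (-(R * u))) := by
  classical
  haveI : Fact p.Prime := ⟨hp⟩
  rcases E.eq_empty_or_nonempty with rfl | ⟨lam0, h0⟩
  · simp; positivity
  have ht : ∀ r, 0 < m r * p ^ J := by
    intro r
    refine Nat.mul_pos (Nat.pos_of_ne_zero ?_) (pow_pos hp.pos _)
    intro h
    exact hmp r (h ▸ dvd_zero p)
  have hsr : ∀ lam ∈ E, ShiftRel n R (fun r => m r * p ^ J) lam := fun lam hlam =>
    exists_shift n p R m hm hmp J lam mu hS (hE lam hlam).2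
  have h1 := card_shift n L R (fun r => m r * p ^ J) ht E (fun lam h => (hE lam h).1) hsr
  have h2 := (shift_data n L R (fun r => m r * p ^ J) ht lam0 (hE lam0 h0).1 (hsr lam0 h0)).1
  have h3 : (E.card : ℝ) ≤ (L : ℝ) ^ R *
      Fintype.card (Nat.Partition (n - ∑ r, m r * p ^ J)) := by exact_mod_cast h1
  refine h3.trans ?_
  gcongr
  refine (part_shift n _ hn h2).trans ?_
  refine mul_le_mul_of_nonneg_left (Real.exp_le_exp.2 (neg_le_neg ?_)) (Real.exp_pos _).le
  push_cast
  rw [Finset.mul_sum]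
  calc (R : ℝ) * u = ∑ r : Fin R, u := by simp
    _ ≤ _ := Finset.sum_le_sum fun r _ => by
      have := hu r
      linarith

lemma card_pairs (n : ℕ) (Pr : Nat.Partition n → Nat.Partition n → Prop) (X Z : ℝ) (hZ : 0 ≤ Z)
    (Bad : Finset (Nat.Partition n)) (hB : (Bad.card : ℝ) ≤ X)
    (h : ∀ mu ∉ Bad, ∀ E : Finset (Nat.Partition n), (∀ lam ∈ E, Pr lam mu) → (E.card : ℝ) ≤ Z) :
    (Nat.card {q : Nat.Partition n × Nat.Partition n // Pr q.1 q.2} : ℝ) ≤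
      (X + Z) * Fintype.card (Nat.Partition n) := by
  classical
  rw [Nat.card_eq_fintype_card, Fintype.card_subtype, Finset.card_filter, Fintype.sum_prod_type_right,
    Nat.cast_sum]
  calc ∑ mu : Nat.Partition n, ((∑ lam : Nat.Partition n, if Pr lam mu then 1 else 0 : ℕ) : ℝ)
      ≤ ∑ mu : Nat.Partition n, ((if mu ∈ Bad then (Fintype.card (Nat.Partition n) : ℝ) else 0) + Z) := by
        refine Finset.sum_le_sum fun mu _ => ?_
        rw [← Finset.card_filter]
        by_cases hmu : mu ∈ Bad
        · rw [if_pos hmu]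
          have : ((Finset.univ.filter (fun lam => Pr lam mu)).card : ℝ) ≤ Fintype.card (Nat.Partition n) := by
            exact_mod_cast Finset.card_le_univ _
          linarith
        · rw [if_neg hmu, zero_add]
          exact h mu hmu _ (fun lam hlam => (Finset.mem_filter.1 hlam).2)
    _ = Bad.card * Fintype.card (Nat.Partition n) + Fintype.card (Nat.Partition n) * Z := by
        rw [Finset.sum_add_distrib, ← Finset.sum_filter]
        simp
    _ ≤ _ := by
        have h0 : (0 : ℝ) ≤ Fintype.card (Nat.Partition n) := Nat.cast_nonneg _
        nlinarith

lemma large_n (p : ℕ) (hp : p.Prime) : ∃ C : ℝ, 0 < C ∧ ∃ N0 : ℕ, ∀ n : ℕ, N0 ≤ n → 1 ≤ n →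
    (Nat.card {q : Nat.Partition n × Nat.Partition n // ¬ (p : ℤ) ∣ charSn n q.1 q.2} : ℝ) ≤
      C * (n : ℝ)⁻¹ * (Fintype.card (Nat.Partition n) : ℝ) ^ 2 := by
  classical
  have hc := cc_pos
  have hc1 := one_le_cc
  have hp0 : (0 : ℝ) < p := by exact_mod_cast hp.pos
  set e : ℝ := 1 / (256 * (p : ℝ) ^ 2) with he
  have he0 : 0 < e := by positivity
  obtain ⟨R, hR⟩ : ∃ R : ℕ, 98 / e ≤ (R : ℝ) := exists_nat_ge _
  have hR1 : 1 ≤ R := by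
    rw [Nat.one_le_iff_ne_zero]; rintro rfl
    have : 0 < 98 / e := by positivity
    simp at hR; linarith
  have hRe : 98 ≤ R * e := by rwa [div_le_iff₀ he0] at hR
  obtain ⟨K, hK, hlow⟩ := part_lower
  set c : ℝ := e / (16 * p ^ 2 * R * cc) with hcdef
  have hR0 : (0 : ℝ) < R := by exact_mod_cast hR1
  have hc0 : 0 < c := by positivity
  have hev : ∀ᶠ n : ℕ in Filter.atTop, 1 ≤ Real.log n ∧ 1 ≤ 8 * e * Real.log n ∧
      2 * cc * p * (4 * p * R * (p + 1) / e) ≤ Real.exp (Real.log n / 4) ∧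
      49 * Real.log n ≤ c * Real.exp (2 * e * Real.log n) ∧
      51 * Real.log n ≤ Real.exp (e / 2 * Real.log n) := by
    have hlog : Filter.Tendsto (fun n : ℕ => Real.log n) Filter.atTop Filter.atTop :=
      Real.tendsto_log_atTop.comp tendsto_natCast_atTop_atTop
    have hexp : ∀ b : ℝ, 0 < b → ∀ A : ℝ, ∀ᶠ y : ℝ in Filter.atTop, A * y ≤ Real.exp (b * y) := by
      intro b hb A
      have h1 : Filter.Tendsto (fun y : ℝ => b * y) Filter.atTop Filter.atTop :=
        Filter.tendsto_id.const_mul_atTop hb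
      have h2 := (Real.tendsto_exp_div_pow_atTop 1).comp h1
      filter_upwards [h2.eventually_ge_atTop (A / b), Filter.eventually_gt_atTop 0] with y hy hy0
      simp only [Function.comp, pow_one] at hy
      rw [div_le_div_iff₀ hb (by positivity)] at hy
      have : (A * y) * b ≤ Real.exp (b * y) * b := by linarith
      exact le_of_mul_le_mul_right this hb
    refine hlog.eventually (p := fun y => 1 ≤ y ∧ 1 ≤ 8 * e * y ∧
      2 * cc * p * (4 * p * R * (p + 1) / e) ≤ Real.exp (y / 4) ∧
      49 * y ≤ c * Real.exp (2 * e * y) ∧ 51 * y ≤ Real.exp (e / 2 * y)) ?_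
    filter_upwards [Filter.eventually_ge_atTop 1, Filter.eventually_ge_atTop (1 / (8 * e)),
      hexp (1 / 4) (by norm_num) (2 * cc * p * (4 * p * R * (p + 1) / e)),
      hexp (2 * e) (by positivity) (49 / c), hexp (e / 2) (by positivity) 51] with y h1 h2 h3 h4 h5
    refine ⟨h1, ?_, ?_, ?_, h5⟩
    · rw [div_le_iff₀ (by positivity)] at h2; linarith
    · rw [show y / 4 = 1 / 4 * y by ring]
      refine le_trans ?_ h3
      exact le_mul_of_one_le_right (by positivity) h1
    · rw [div_mul_eq_mul_div, div_le_iff₀ hc0] at h4; linarith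
  obtain ⟨N0, hN0⟩ := Filter.eventually_atTop.1 hev
  refine ⟨(R + 2) / K, by positivity, N0, ?_⟩
  intro n hnN hn
  obtain ⟨hl1, hl2, hl3, hl4, hl5⟩ := hN0 n hnN
  have hn0 : (0 : ℝ) < n := by exact_mod_cast hn
  have hs : 0 < Real.sqrt n := Real.sqrt_pos.2 hn0
  have hx0 : 0 < cc / Real.sqrt n := by positivity
  have hnexp : Real.exp (Real.log n) = n := Real.exp_log hn0
  have hsexp : Real.sqrt n = Real.exp (Real.log n / 2) := by
    rw [Real.sqrt_eq_iff_mul_self_eq hn0.le (Real.exp_pos _).le, ← Real.exp_add, add_halves, hnexp]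
  set l := Real.log n with hl
  have hxexp : cc / Real.sqrt n = cc * Real.exp (-(l / 2)) := by
    rw [hsexp, Real.exp_neg]; rfl
  obtain ⟨I, J, G, ρ, hI, hJ, g1, g2, g3, g4, g5, g6, g7⟩ :=
    groups_core p R hp hR1 l (cc / Real.sqrt n) e he hxexp hl1 hl2 hl3
  set N : ℝ := (Fintype.card (Nat.Partition n) : ℝ) with hN
  have hNn : 0 ≤ N := Nat.cast_nonneg _
  set E0 := Real.exp (2 * cc * Real.sqrt n) with hE0
  have hE0p : 0 < E0 := Real.exp_pos _
  have hlow1 : E0 ≤ Real.exp (48 * l) / K * N := by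
    have h1 := hlow n hn
    unfold ff at h1
    have h2 : (n : ℝ) ^ 48 = Real.exp (48 * l) := by
      rw [← hnexp, ← Real.exp_nat_mul]; norm_num
    rw [h2, ← mul_div_assoc, div_le_iff₀ (Real.exp_pos _)] at h1
    rw [div_mul_eq_mul_div, le_div_iff₀ hK]
    linarith
  have hinv : (n : ℝ)⁻¹ = Real.exp (-l) := by rw [Real.exp_neg, hnexp]
  set L := ⌈50 * Real.sqrt n * l⌉₊ with hL
  have hL1 : 50 * Real.sqrt n * l ≤ L := Nat.le_ceil _
  have hs1 : 1 ≤ Real.sqrt n := by rw [hsexp]; exact Real.one_le_exp (by linarith)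
  have hL2 : (L : ℝ) ≤ Real.exp ((1 / 2 + e / 2) * l) := by
    have h1 : (L : ℝ) ≤ 50 * Real.sqrt n * l + 1 := (Nat.ceil_lt_add_one (by positivity)).le
    have h2 : (1 : ℝ) * 1 ≤ Real.sqrt n * l := mul_le_mul hs1 hl1 zero_le_one hs.le
    calc (L : ℝ) ≤ Real.sqrt n * (51 * l) := by linarith
      _ ≤ Real.sqrt n * Real.exp (e / 2 * l) := by gcongr
      _ = _ := by rw [hsexp, ← Real.exp_add]; congr 1; ring
  -- three estimates
  have est : ∀ a y : ℝ, 0 ≤ a → y ≤ -(49 * l) → a * (E0 * Real.exp y) ≤ a * (Real.exp (-l) * N / K) := by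
    intro a y ha hy
    gcongr
    calc E0 * Real.exp y ≤ (Real.exp (48 * l) / K * N) * Real.exp (-(49 * l)) := by gcongr
      _ = (Real.exp (48 * l) * Real.exp (-(49 * l))) * N / K := by ring
      _ = Real.exp (-l) * N / K := by rw [← Real.exp_add]; congr 3; ring
  set Bad : Finset (Nat.Partition n) := Finset.univ.filter (fun μ => ∃ r, ∀ m ∈ G r,
      ¬ p ^ J ≤ ∑ j ∈ Finset.range J, p ^ j * μ.parts.count (m * p ^ j)) with hBad
  have hBadc : (Bad.card : ℝ) ≤ R * (Real.exp (-l) * N / K) := by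
    refine (bad_mu_card n hn p I J R hp hI hJ G ρ (c * Real.exp (2 * e * l)) g1 g2 g3 g4 g5 Bad
      (fun μ hμ => (Finset.mem_filter.1 hμ).2)).trans ?_
    have := est R (-(c * Real.exp (2 * e * l))) hR0.le (by linarith)
    refine le_trans (le_of_eq ?_) this
    rw [hE0]; ring
  have hfin := card_pairs n (fun lam mu => ¬ (p : ℤ) ∣ charSn n lam mu) (R * (Real.exp (-l) * N / K))
    (2 * (Real.exp (-l) * N / K)) (by positivity) Bad hBadc (by
      intro mu hmu E hE
      have hgood : ∀ r, ∃ m ∈ G r, p ^ J ≤ ∑ j ∈ Finset.range J, p ^ j * mu.parts.count (m * p ^ j) := by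
        intro r
        by_contra hcon
        push Not at hcon
        apply hmu
        rw [hBad, Finset.mem_filter]
        exact ⟨Finset.mem_univ _, r, fun m hm => not_le.2 (hcon m hm)⟩
      choose m hmG hmS using hgood
      have hminj : Function.Injective m := by
        intro r r' hrr
        by_contra hne
        exact Finset.disjoint_left.1 (g7 r r' hne) (hmG r) (hrr ▸ hmG r')
      have k1 := many_rows n L hn (E.filter (fun lam => L < lam.parts.card))
        (fun lam h => (Finset.mem_filter.1 h).2)
      have k2 := few_rows n p J L R hn hp mu m hminj (fun r => g1 r _ (hmG r)) ((1 / 2 + e) * l)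
        (fun r => g6 r _ (hmG r)) hmS (E.filter (fun lam => ¬ L < lam.parts.card))
        (fun lam h => ⟨not_lt.1 (Finset.mem_filter.1 h).2, hE lam (Finset.mem_filter.1 h).1⟩)
      have k3 : (E.card : ℝ) = (E.filter (fun lam => L < lam.parts.card)).card +
          (E.filter (fun lam => ¬ L < lam.parts.card)).card := by
        rw [← Nat.cast_add, Finset.card_filter_add_card_filter_not]
      have k4 : (n : ℝ) * (E0 * Real.exp (-(cc / Real.sqrt n * L))) ≤ 1 * (Real.exp (-l) * N / K) := by
        have h1 : 50 * l ≤ cc / Real.sqrt n * L := by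
          calc 50 * l ≤ cc * (50 * l) := le_mul_of_one_le_left (by positivity) hc1
            _ = cc / Real.sqrt n * (50 * Real.sqrt n * l) := by field_simp
            _ ≤ _ := by gcongr
        refine le_trans (le_of_eq ?_) (est 1 (l + -(cc / Real.sqrt n * L)) zero_le_one (by linarith))
        rw [Real.exp_add, hnexp]; ring
      have k5 : (L : ℝ) ^ R * (E0 * Real.exp (-(R * ((1 / 2 + e) * l)))) ≤ 1 * (Real.exp (-l) * N / K) := by
        refine le_trans ?_ (est 1 (R * ((1 / 2 + e / 2) * l) + -(R * ((1 / 2 + e) * l))) zero_le_one ?_)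
        · rw [Real.exp_add, Real.exp_nat_mul, one_mul]
          calc (L : ℝ) ^ R * (E0 * Real.exp (-(R * ((1 / 2 + e) * l))))
              ≤ Real.exp ((1 / 2 + e / 2) * l) ^ R * (E0 * Real.exp (-(R * ((1 / 2 + e) * l)))) := by gcongr
            _ = _ := by ring
        · have := mul_le_mul_of_nonneg_right hRe (by linarith : 0 ≤ l / 2)
          linarith
      linarith)
  refine hfin.trans (le_of_eq ?_)
  rw [hinv]; ring

theorem density_entries_not_divisible :
    ∀ p ∈ ({2, 3, 5, 7, 11, 13} : Finset ℕ),
      ∃ δ : ℝ, 0 < δ ∧ ∃ C : ℝ, 0 < C ∧ ∀ n : ℕ, 1 ≤ n →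
        (Nat.card {q : Nat.Partition n × Nat.Partition n //
            ¬ (p : ℤ) ∣ charSn n q.1 q.2} : ℝ) ≤
          C * (n : ℝ) ^ (-δ) * (Nat.card (Nat.Partition n) : ℝ) ^ 2 := by
  intro p hp
  have hpp : p.Prime := by
    simp only [Finset.mem_insert, Finset.mem_singleton] at hp
    rcases hp with rfl | rfl | rfl | rfl | rfl | rfl <;> norm_num
  obtain ⟨C, hC, N0, h⟩ := large_n p hpp
  refine ⟨1, one_pos, C + N0, by positivity, ?_⟩
  intro n hn
  have hn0 : (0 : ℝ) < n := by exact_mod_cast hn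
  rw [Real.rpow_neg_one, Nat.card_eq_fintype_card (α := Nat.Partition n)]
  rcases le_or_gt N0 n with hle | hlt
  · refine (h n hle hn).trans ?_
    gcongr
    have : (0 : ℝ) ≤ N0 := Nat.cast_nonneg _
    linarith
  · have h1 : Nat.card {q : Nat.Partition n × Nat.Partition n // ¬ (p : ℤ) ∣ charSn n q.1 q.2} ≤
        Fintype.card (Nat.Partition n) ^ 2 := by
      classical
      rw [Nat.card_eq_fintype_card, sq, ← Fintype.card_prod]
      exact Fintype.card_subtype_le _
    have h2 : (Nat.card {q : Nat.Partition n × Nat.Partition n // ¬ (p : ℤ) ∣ charSn n q.1 q.2} : ℝ) ≤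
        1 * (Fintype.card (Nat.Partition n) : ℝ) ^ 2 := by
      rw [one_mul]; exact_mod_cast h1
    refine h2.trans ?_
    gcongr
    rw [← div_eq_mul_inv, le_div_iff₀ hn0, one_mul]
    have : (n : ℝ) ≤ N0 := by exact_mod_cast hlt.le
    linarith
end

section
/- (Mahler) The number q_p(n) of partitions of n into powers of p satisfies log q_p(n) = (1/(2 log p))·(log((n/p)/log(n/p)))² + (1/2 + 1/log p + (log log p)/log p)·log n + O_p(log log n). -/
open Real

/-- `q_p(n)`: the number of partitions of `n` all of whose parts are powers of `p`. -/
noncomputable def qPow (p n : ℕ) : ℕ :=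
  Nat.card {μ : Nat.Partition n // ∀ a ∈ μ.parts, ∃ j : ℕ, a = p ^ j}

lemma sum_scale (p : ℕ) (m : Multiset ℕ) : (m.map (fun a => p * a)).sum = p * m.sum := by
  induction m using Multiset.induction_on with
  | empty => simp
  | cons a s ih => simp [ih, mul_add]

def powParts (p n : ℕ) : Set (Multiset ℕ) :=
  {m | (∀ a ∈ m, ∃ j : ℕ, a = p ^ j) ∧ m.sum = n}

lemma qPow_eq_ncard (p n : ℕ) (hp : 2 ≤ p) : qPow p n = (powParts p n).ncard := by
  unfold qPow
  rw [← Nat.card_coe_set_eq]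
  refine Nat.card_congr ⟨fun μ => ⟨μ.1.parts, μ.2, μ.1.parts_sum⟩,
    fun m => ⟨⟨m.1, ?_, m.2.2⟩, m.2.1⟩, ?_, ?_⟩
  · intro i hi
    obtain ⟨j, rfl⟩ := m.2.1 i hi
    positivity
  · intro μ; rfl
  · intro m; rfl

lemma powParts_finite (p n : ℕ) (hp : 2 ≤ p) : (powParts p n).Finite := by
  have : powParts p n ⊆ Set.range (fun μ : Nat.Partition n => μ.parts) := by
    intro m hm
    refine ⟨⟨m, ?_, hm.2⟩, rfl⟩
    intro i hi
    obtain ⟨j, rfl⟩ := hm.1 i hi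
    positivity
  exact (Set.finite_range _).subset this

def addOnes (p : ℕ) (m : Multiset ℕ) : Multiset ℕ := m + Multiset.replicate p 1

def scaleUp (p r : ℕ) (m : Multiset ℕ) : Multiset ℕ :=
  m.map (fun a => p * a) + Multiset.replicate r 1

lemma addOnes_inj (p : ℕ) : Function.Injective (addOnes p) := by
  intro a b h
  simpa [addOnes] using h

lemma scaleUp_inj (p r : ℕ) (hp : 2 ≤ p) : Function.Injective (scaleUp p r) := by
  intro a b h
  have h' : a.map (fun a => p * a) = b.map (fun a => p * a) := by
    simpa [scaleUp] using h
  refine Multiset.map_injective ?_ h'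
  intro x y hxy
  exact Nat.eq_of_mul_eq_mul_left (by omega) hxy

lemma image_addOnes (p n : ℕ) (hn : p ≤ n) :
    addOnes p '' powParts p (n - p) = {m ∈ powParts p n | p ≤ m.count 1} := by
  ext m
  constructor
  · rintro ⟨m', ⟨h1, h2⟩, rfl⟩
    refine ⟨⟨?_, ?_⟩, ?_⟩
    · intro a ha
      rcases Multiset.mem_add.1 ha with h | h
      · exact h1 a h
      · exact ⟨0, by simpa using Multiset.eq_of_mem_replicate h⟩
    · simp [addOnes, h2]; omega
    · simp [addOnes]
  · rintro ⟨⟨h1, h2⟩, h3⟩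
    have hle := Multiset.le_count_iff_replicate_le.1 h3
    refine ⟨m - Multiset.replicate p 1, ⟨?_, ?_⟩, ?_⟩
    · intro a ha
      exact h1 a (Multiset.mem_of_le (Multiset.sub_le_self _ _) ha)
    · have := congrArg Multiset.sum (Multiset.sub_add_cancel hle)
      simp at this
      omega
    · exact Multiset.sub_add_cancel hle

lemma image_scaleUp (p n : ℕ) (hp : 2 ≤ p) :
    scaleUp p (n % p) '' powParts p (n / p) = {m ∈ powParts p n | ¬ p ≤ m.count 1} := by
  ext m
  constructor
  · rintro ⟨m', ⟨h1, h2⟩, rfl⟩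
    refine ⟨⟨?_, ?_⟩, ?_⟩
    · intro a ha
      rcases Multiset.mem_add.1 ha with h | h
      · obtain ⟨b, hb, rfl⟩ := Multiset.mem_map.1 h
        obtain ⟨j, rfl⟩ := h1 b hb
        exact ⟨j + 1, by ring⟩
      · exact ⟨0, by simpa using Multiset.eq_of_mem_replicate h⟩
    · simp only [scaleUp, Multiset.sum_add, sum_scale,
        Multiset.sum_replicate, h2, smul_eq_mul, mul_one]
      exact Nat.div_add_mod n p
    · have h0 : Multiset.count 1 (m'.map (fun a => p * a)) = 0 := by
        rw [Multiset.count_eq_zero]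
        intro h
        obtain ⟨b, hb, hb'⟩ := Multiset.mem_map.1 h
        have := Nat.eq_one_of_mul_eq_one_right hb'
        omega
      have := Nat.mod_lt n (show p > 0 by omega)
      simp only [scaleUp, Multiset.count_add, h0, Multiset.count_replicate_self]
      omega
  · rintro ⟨⟨h1, h2⟩, h3⟩
    have hsplit : m.filter (fun a => ¬ a = 1) + Multiset.replicate (m.count 1) 1 = m := by
      have := Multiset.filter_add_not (fun a => a = 1) m
      rw [Multiset.filter_eq', add_comm] at this
      exact this
    set f := m.filter (fun a => ¬ a = 1) with hf
    have hfm : ∀ a ∈ f, ∃ j, a = p * p ^ j := by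
      intro a ha
      obtain ⟨ha1, ha2⟩ := Multiset.mem_filter.1 ha
      obtain ⟨j, rfl⟩ := h1 a ha1
      rcases j with _ | j
      · simp at ha2
      · exact ⟨j, by ring⟩
    set g := f.map (fun a => a / p) with hg
    have hgf : g.map (fun a => p * a) = f := by
      rw [hg, Multiset.map_map]
      conv_rhs => rw [← Multiset.map_id f]
      refine Multiset.map_congr rfl ?_
      intro a ha
      obtain ⟨j, rfl⟩ := hfm a ha
      simp only [Function.comp, id]
      rw [Nat.mul_div_cancel_left _ (by omega)]
    have hsum : p * g.sum + m.count 1 = n := by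
      have h := congrArg Multiset.sum hsplit
      rw [← hgf, Multiset.sum_add, sum_scale] at h
      simp only [Multiset.sum_replicate, smul_eq_mul, mul_one] at h
      omega
    have hmod : n % p = m.count 1 := by
      rw [← hsum, Nat.mul_add_mod, Nat.mod_eq_of_lt (by omega)]
    have hdiv : n / p = g.sum := by
      rw [← hsum, Nat.mul_add_div (by omega), Nat.div_eq_of_lt (a := m.count 1) (by omega), add_zero]
    refine ⟨g, ⟨?_, hdiv.symm⟩, ?_⟩
    · intro a ha
      obtain ⟨b, hb, rfl⟩ := Multiset.mem_map.1 ha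
      obtain ⟨j, rfl⟩ := hfm b hb
      exact ⟨j, Nat.mul_div_cancel_left _ (by omega)⟩
    · rw [scaleUp, hgf, hmod, hsplit]

lemma qPow_rec (p n : ℕ) (hp : 2 ≤ p) (hn : p ≤ n) :
    qPow p n = qPow p (n - p) + qPow p (n / p) := by
  rw [qPow_eq_ncard p n hp, qPow_eq_ncard p _ hp, qPow_eq_ncard p _ hp,
    ← Set.ncard_image_of_injective (powParts p (n - p)) (addOnes_inj p),
    ← Set.ncard_image_of_injective (powParts p (n / p)) (scaleUp_inj p (n % p) hp),
    image_addOnes p n hn, image_scaleUp p n hp,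
    ← Set.ncard_union_eq ?_ ((powParts_finite p n hp).subset (fun m hm => hm.1))
      ((powParts_finite p n hp).subset (fun m hm => hm.1))]
  · congr 1
    ext m
    simp only [Set.mem_union, Set.mem_ofPred_eq]
    tauto
  · rw [Set.disjoint_left]
    rintro m ⟨_, h⟩ ⟨_, h'⟩
    exact h' h

lemma qPow_small (p n : ℕ) (hp : 2 ≤ p) (hn : n < p) : qPow p n = 1 := by
  rw [qPow_eq_ncard p n hp, Set.ncard_eq_one]
  refine ⟨Multiset.replicate n 1, ?_⟩
  ext m
  simp only [Set.mem_singleton_iff]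
  constructor
  · rintro ⟨h1, h2⟩
    have : ∀ a ∈ m, a = 1 := by
      intro a ha
      have hle := Multiset.le_sum_of_mem ha
      rw [h2] at hle
      obtain ⟨j, rfl⟩ := h1 a ha
      rcases j with _ | j
      · simp
      · have : p ^ 1 ≤ p ^ (j + 1) := Nat.pow_le_pow_right (by omega) (by omega)
        rw [pow_one] at this
        omega
    have h3 := Multiset.eq_replicate_card.2 this
    have h4 : m.card = n := by rw [← h2]; conv_rhs => rw [h3]
                               simp
    rw [h3, h4]
  · rintro rfl
    refine ⟨?_, by simp⟩
    intro a ha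
    exact ⟨0, by simpa using Multiset.eq_of_mem_replicate ha⟩

/-- One step of the Chernoff type upper bound. -/
lemma upper_step (p : ℕ) (hp : 2 ≤ p) (s H G : ℝ) (hs : 0 < s) (hG : 1 ≤ G)
    (hH : ∀ n : ℕ, (qPow p n : ℝ) ≤ exp (p * s * n) * H)
    (hH0 : 0 ≤ H) (hGH : H ≤ (1 - exp (-(s * p))) * G) (n : ℕ) :
    (qPow p n : ℝ) ≤ exp (s * n) * G := by
  induction n using Nat.strong_induction_on with
  | _ n ih =>
    by_cases hn : n < p
    · rw [qPow_small p n hp hn]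
      have : 1 ≤ exp (s * n) := Real.one_le_exp (by positivity)
      push_cast
      nlinarith
    · push Not at hn
      rw [qPow_rec p n hp hn]
      push_cast
      have h1 := ih (n - p) (by omega)
      have h2 := hH (n / p)
      have h3 : exp (p * s * (n / p : ℕ)) ≤ exp (s * n) := by
        apply Real.exp_le_exp.2
        have : (p : ℝ) * (n / p : ℕ) ≤ n := by exact_mod_cast Nat.mul_div_le n p
        nlinarith
      have h4 : exp (s * (n - p : ℕ)) = exp (s * n) * exp (-(s * p)) := by
        rw [← Real.exp_add, Nat.cast_sub hn]; ring_nf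
      rw [h4] at h1
      have h5 : exp (p * s * (n / p : ℕ)) * H ≤ exp (s * n) * ((1 - exp (-(s * p))) * G) :=
        mul_le_mul h3 hGH hH0 (by positivity)
      calc _ ≤ exp (s * n) * exp (-(s * p)) * G + exp (s * n) * ((1 - exp (-(s * p))) * G) := by
              linarith
        _ = _ := by ring

lemma exp_bound_a (y : ℝ) (hy : 0 < y) : exp (-(1 / y)) ≤ 1 - exp (-y) := by
  have h1 : y + 1 ≤ exp y := Real.add_one_le_exp y
  have h2 : 1 / y + 1 ≤ exp (1 / y) := Real.add_one_le_exp _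
  rw [Real.exp_neg, Real.exp_neg]
  have h3 : (exp (1 / y))⁻¹ ≤ (1 / y + 1)⁻¹ := inv_anti₀ (by positivity) h2
  have h4 : (exp y)⁻¹ ≤ (y + 1)⁻¹ := inv_anti₀ (by positivity) h1
  have h5 : (1 / y + 1)⁻¹ = 1 - (y + 1)⁻¹ := by field_simp; ring
  linarith

lemma exp_bound_b (y : ℝ) (hy : 0 < y) : exp (log y - y) ≤ 1 - exp (-y) := by
  have h1 : y + 1 ≤ exp y := Real.add_one_le_exp y
  rw [Real.exp_sub, Real.exp_log hy, Real.exp_neg, div_le_iff₀ (by positivity), sub_mul,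
    inv_mul_cancel₀ (by positivity)]
  linarith

lemma upper_base_aux (p : ℕ) (hp : 2 ≤ p) (n : ℕ) : ∀ s : ℝ, 0 < s →
    (qPow p n : ℝ) ≤ exp (s * n) * exp (1 / s) := by
  have hp' : (2 : ℝ) ≤ p := by exact_mod_cast hp
  induction n using Nat.strong_induction_on with
  | _ n ih =>
    intro s hs
    by_cases hn : n < p
    · rw [qPow_small p n hp hn, ← Real.exp_add]
      push_cast
      exact Real.one_le_exp (by positivity)
    · push Not at hn
      rw [qPow_rec p n hp hn]
      push_cast
      have h1 := ih (n - p) (by omega) s hs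
      have h2 := ih (n / p) (Nat.div_lt_self (by omega) (by omega)) (p * s) (by positivity)
      have h3 : exp (p * s * (n / p : ℕ)) ≤ exp (s * n) := by
        apply Real.exp_le_exp.2
        have : (p : ℝ) * (n / p : ℕ) ≤ n := by exact_mod_cast Nat.mul_div_le n p
        nlinarith
      have h4 : exp (s * (n - p : ℕ)) = exp (s * n) * exp (-(s * p)) := by
        rw [← Real.exp_add, Nat.cast_sub hn]; ring_nf
      rw [h4] at h1
      have h6 : exp (1 / (p * s)) ≤ (1 - exp (-(s * p))) * exp (1 / s) := by
        have h7 := exp_bound_a (s * p) (by positivity)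
        calc exp (1 / (p * s)) ≤ exp (-(1 / (s * p))) * exp (1 / s) := by
              rw [← Real.exp_add]
              apply Real.exp_le_exp.2
              have : 1 / s = p * (1 / (s * p)) := by field_simp
              rw [this, mul_comm (p : ℝ) s]
              have : 0 < 1 / (s * p) := by positivity
              nlinarith
          _ ≤ _ := by gcongr
      have h5 : exp (p * s * (n / p : ℕ)) * exp (1 / (p * s)) ≤
          exp (s * n) * ((1 - exp (-(s * p))) * exp (1 / s)) :=
        mul_le_mul h3 h6 (by positivity) (by positivity)
      calc _ ≤ exp (s * n) * exp (-(s * p)) * exp (1 / s) +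
            exp (s * n) * ((1 - exp (-(s * p))) * exp (1 / s)) := by
              linarith
        _ = _ := by ring

lemma upper_general (p : ℕ) (hp : 2 ≤ p) (K : ℕ) : ∀ (n : ℕ) (s : ℝ), 0 < s → s * p ^ K ≤ 1 →
    (qPow p n : ℝ) ≤ exp (s * n) * exp (1 / (s * p ^ K) + 2 * (s * p ^ K) - 2 * s
      - K * log s - log p * K * (K + 1) / 2) := by
  have hp' : (2 : ℝ) ≤ p := by exact_mod_cast hp
  induction K with
  | zero =>
    intro n s hs _
    simpa using upper_base_aux p hp n s hs
  | succ K ih =>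
    intro n s hs hsK
    have hL : 0 < log p := Real.log_pos (by linarith)
    have hlog : log (p * s) = log p + log s := Real.log_mul (by positivity) (by positivity)
    have hpow : s * (p : ℝ) ^ (K + 1) = p * s * p ^ K := by ring
    have hone : ∀ m : ℕ, (1 : ℝ) ≤ p ^ m := fun m => one_le_pow₀ (by linarith)
    refine upper_step p hp s _ _ hs ?_ (fun m => ih m (p * s) (by positivity) (by rw [← hpow]; exact hsK))
      (by positivity) ?_ n
    · apply Real.one_le_exp
      have h1 : 0 ≤ 1 / (s * (p : ℝ) ^ (K + 1)) := by positivity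
      have h2 : s ≤ s * (p : ℝ) ^ (K + 1) := le_mul_of_one_le_right hs.le (hone _)
      have h3 : log s ≤ -(log p * (K + 1)) := by
        have := Real.log_nonpos (by positivity) hsK
        rw [Real.log_mul (by positivity) (by positivity), Real.log_pow] at this
        push_cast at this
        linarith
      push_cast
      have hK : (0 : ℝ) ≤ K := by positivity
      have h4 : 0 ≤ ((K : ℝ) + 1) * (-(log p * (K + 1)) - log s) := by
        apply mul_nonneg <;> linarith
      have h5 : 0 ≤ log p * K * (K + 1) := by positivity
      nlinarith
    · have h7 := exp_bound_b (s * p) (by positivity)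
      refine le_trans ?_ (mul_le_mul_of_nonneg_right h7 (by positivity))
      rw [← Real.exp_add]
      apply Real.exp_le_exp.2
      rw [hpow, mul_comm s (p : ℝ), hlog]
      push_cast
      nlinarith

lemma pow_sub_bound (x a : ℝ) (ha : 0 ≤ a) (hx : a ≤ x) (J : ℕ) :
    x ^ (J + 1) - (x - a) ^ (J + 1) ≤ (J + 1) * a * x ^ J := by
  induction J with
  | zero => simp
  | succ J ih =>
    have h1 : (x - a) ^ (J + 1) ≤ x ^ (J + 1) := pow_le_pow_left₀ (by linarith) (by linarith) _
    have h2 : x * (x ^ (J + 1) - (x - a) ^ (J + 1)) ≤ x * ((J + 1) * a * x ^ J) :=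
      mul_le_mul_of_nonneg_left ih (by linarith)
    have h3 : a * (x - a) ^ (J + 1) ≤ a * x ^ (J + 1) := mul_le_mul_of_nonneg_left h1 ha
    push_cast
    calc x ^ (J + 1 + 1) - (x - a) ^ (J + 1 + 1)
        = x * (x ^ (J + 1) - (x - a) ^ (J + 1)) + a * (x - a) ^ (J + 1) := by ring
      _ ≤ x * ((J + 1) * a * x ^ J) + a * x ^ (J + 1) := by linarith
      _ = _ := by ring

noncomputable def lowC (p : ℕ) : ℕ → ℝ
  | 0 => 1
  | J + 1 => lowC p J / ((J + 1) * p ^ (J + 1))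

lemma lowC_pos (p : ℕ) (hp : 2 ≤ p) (J : ℕ) : 0 < lowC p J := by
  induction J with
  | zero => simp [lowC]
  | succ J ih => rw [lowC]; positivity

lemma lowC_small (p : ℕ) (hp : 2 ≤ p) (J : ℕ) : p ^ J * lowC p J ≤ 1 := by
  have hp' : (2 : ℝ) ≤ p := by exact_mod_cast hp
  have hle : ∀ J, lowC p J ≤ 1 := by
    intro J
    induction J with
    | zero => simp [lowC]
    | succ J ih =>
      rw [lowC, div_le_one (by positivity)]
      have : (1 : ℝ) ≤ p ^ (J + 1) := one_le_pow₀ (by linarith)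
      have hJ : (0 : ℝ) ≤ J := by positivity
      nlinarith
  rcases J with _ | J
  · simp [lowC]
  · have : (p : ℝ) ^ (J + 1) * lowC p (J + 1) = lowC p J / (J + 1) := by
      rw [lowC]; field_simp
    rw [this, div_le_one (by positivity)]
    have hJ : (0 : ℝ) ≤ J := by positivity
    linarith [hle J]

lemma lower_general (p : ℕ) (hp : 2 ≤ p) (J : ℕ) : ∀ n : ℕ,
    ((n : ℝ) + 1) ^ J * lowC p J ≤ qPow p n := by
  have hp' : (2 : ℝ) ≤ p := by exact_mod_cast hp
  have hsmall : ∀ (J n : ℕ), n < p → ((n : ℝ) + 1) ^ J * lowC p J ≤ qPow p n := by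
    intro J n hn
    rw [qPow_small p n hp hn]
    have h1 : ((n : ℝ) + 1) ^ J ≤ p ^ J :=
      pow_le_pow_left₀ (by positivity) (by exact_mod_cast hn) _
    have := mul_le_mul_of_nonneg_right h1 (lowC_pos p hp J).le
    push_cast
    linarith [lowC_small p hp J]
  induction J with
  | zero =>
    intro n
    induction n using Nat.strong_induction_on with
    | _ n ih =>
      by_cases hn : n < p
      · exact hsmall 0 n hn
      · push Not at hn
        rw [qPow_rec p n hp hn]
        have := ih (n - p) (by omega)
        simp only [pow_zero] at this ⊢
        push_cast
        have h2 : (0 : ℝ) ≤ qPow p (n / p) := by positivity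
        linarith
  | succ J ihJ =>
    intro n
    induction n using Nat.strong_induction_on with
    | _ n ih =>
      by_cases hn : n < p
      · exact hsmall _ n hn
      · push Not at hn
        have hn' : (p : ℝ) ≤ n := by exact_mod_cast hn
        rw [qPow_rec p n hp hn]
        have h1 := ih (n - p) (by omega)
        have h2 := ihJ (n / p)
        have h3 : ((n : ℝ) + 1) / p ≤ (n / p : ℕ) + 1 := by
          rw [div_le_iff₀ (by positivity)]
          have := Nat.lt_div_mul_add (a := n) (b := p) (by omega)
          have h : n + 1 ≤ (n / p + 1) * p := by rw [add_mul]; omega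
          exact_mod_cast h
        have h4 : (((n : ℝ) + 1) / p) ^ J ≤ (((n / p : ℕ) : ℝ) + 1) ^ J :=
          pow_le_pow_left₀ (by positivity) h3 _
        have h5 := mul_le_mul_of_nonneg_right h4 (lowC_pos p hp J).le
        have h6 := pow_sub_bound ((n : ℝ) + 1) p (by positivity) (by linarith) J
        have h7 := mul_le_mul_of_nonneg_right h6 (lowC_pos p hp (J + 1)).le
        have h8 : ((J : ℝ) + 1) * p * ((n : ℝ) + 1) ^ J * lowC p (J + 1) =
            (((n : ℝ) + 1) / p) ^ J * lowC p J := by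
          rw [lowC, div_pow]; field_simp; ring
        rw [Nat.cast_sub hn] at h1
        have h9 : ((n : ℝ) - p + 1) = (n + 1 - p) := by ring
        rw [h9] at h1
        push_cast
        rw [h8] at h7
        linarith

lemma log_lowC (p : ℕ) (hp : 2 ≤ p) (J : ℕ) :
    -((J + 1 : ℝ) * log (J + 1) - J)
      - log p * J * (J + 1) / 2 ≤ log (lowC p J) := by
  have hp' : (2 : ℝ) ≤ p := by exact_mod_cast hp
  induction J with
  | zero => simp [lowC]
  | succ J ih =>
    have hC := lowC_pos p hp J
    rw [lowC, Real.log_div (by positivity) (by positivity),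
      Real.log_mul (by positivity) (by positivity), Real.log_pow]
    push_cast
    have h1 : 1 - (((J : ℝ) + 1 + 1) / (J + 1))⁻¹ ≤ log (((J : ℝ) + 1 + 1) / (J + 1)) :=
      Real.one_sub_inv_le_log_of_pos (by positivity)
    rw [Real.log_div (by positivity) (by positivity), inv_div] at h1
    have h2 : (J + 1 + 1 : ℝ) * (1 - ((J : ℝ) + 1) / (J + 1 + 1)) = 1 := by field_simp; ring
    have h3 := mul_le_mul_of_nonneg_left h1 (show (0 : ℝ) ≤ J + 1 + 1 by positivity)
    rw [h2] at h3
    nlinarith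

lemma floor_identity (L Λ k : ℝ) (hL : 0 < L) (h1 : k ≤ Λ / L) (h2 : Λ / L < k + 1) :
    k * Λ - L * k * (k + 1) / 2 ≤ Λ ^ 2 / (2 * L) - Λ / 2 + L ∧
    Λ ^ 2 / (2 * L) - Λ / 2 - L ≤ k * Λ - L * k * (k + 1) / 2 := by
  obtain ⟨t, rfl⟩ : ∃ t, Λ = L * t := ⟨Λ / L, by field_simp⟩
  have ht : L * t / L = t := by field_simp
  rw [ht] at h1 h2
  have h3 : (L * t) ^ 2 / (2 * L) = L * (t ^ 2 / 2) := by field_simp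
  rw [h3]
  have h4 : k * (L * t) - L * k * (k + 1) / 2 =
      L * (t ^ 2 / 2) - L * t / 2 + L * ((t - k) / 2 - (t - k) ^ 2 / 2) := by ring
  rw [h4]
  have h5 : (t - k) / 2 - (t - k) ^ 2 / 2 ≤ 1 := by nlinarith
  have h6 : -1 ≤ (t - k) / 2 - (t - k) ^ 2 / 2 := by nlinarith
  constructor <;> nlinarith

lemma upper_final (p : ℕ) (hp : 2 ≤ p) (n : ℕ) (hn : 2 ≤ n) (Λ : ℝ)
    (hΛ : Λ = log n - log (log n) + log (log p)) (h0 : 0 ≤ Λ) (hq : 0 < qPow p n) :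
    log (qPow p n) ≤ Λ ^ 2 / (2 * log p) - Λ / 2 + log n / log p + (p + 2 + log p) := by
  have hp' : (2 : ℝ) ≤ p := by exact_mod_cast hp
  have hn' : (2 : ℝ) ≤ n := by exact_mod_cast hn
  have hL : 0 < log p := Real.log_pos (by linarith)
  have hM : 0 < log n := Real.log_pos (by linarith)
  set s : ℝ := log n / (log p * n) with hs
  have hs0 : 0 < s := by positivity
  have hlogs : log s = -Λ := by
    rw [hs, hΛ, Real.log_div (by positivity) (by positivity),
      Real.log_mul (by positivity) (by positivity)]
    ring
  set K := ⌊Λ / log p⌋₊ with hK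
  have hK1 : (K : ℝ) ≤ Λ / log p := Nat.floor_le (by positivity)
  have hK2 : Λ / log p < K + 1 := Nat.lt_floor_add_one _
  have hsn : s * n = log n / log p := by rw [hs]; field_simp
  have hlsp : log (s * p ^ K) = -Λ + K * log p := by
    rw [Real.log_mul (by positivity) (by positivity), hlogs, Real.log_pow]
  have hpos : 0 < s * (p : ℝ) ^ K := by positivity
  have hle : s * (p : ℝ) ^ K ≤ 1 := by
    rw [← Real.log_nonpos_iff hpos.le, hlsp]
    rw [le_div_iff₀ hL] at hK1
    linarith
  have hge : 1 / (s * (p : ℝ) ^ K) ≤ p := by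
    rw [← Real.log_le_log_iff (by positivity) (by positivity), one_div, Real.log_inv, hlsp]
    rw [div_lt_iff₀ hL] at hK2
    linarith
  have h := upper_general p hp K n s hs0 hle
  rw [← Real.exp_add] at h
  have hq' : (0 : ℝ) < qPow p n := by exact_mod_cast hq
  have h' := (Real.log_le_iff_le_exp hq').2 h
  have h3 := (floor_identity (log p) Λ K hL hK1 hK2).1
  rw [hsn, hlogs] at h'
  linarith

lemma lower_final (p : ℕ) (hp : 2 ≤ p) (n : ℕ) (hn : 2 ≤ n) (Λ : ℝ)
    (hΛ : Λ = log n - log (log n) + log (log p)) (h0 : 0 ≤ Λ)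
    (hbig : log (log p) + log p ≤ log (log n)) :
    Λ ^ 2 / (2 * log p) - Λ / 2 + log n / log p - (log p + 1 +
      (log (log n) - log (log p)) / log p + (log (log n) - log (log p))) ≤ log (qPow p n) := by
  have hp' : (2 : ℝ) ≤ p := by exact_mod_cast hp
  have hn' : (2 : ℝ) ≤ n := by exact_mod_cast hn
  have hL : 0 < log p := Real.log_pos (by linarith)
  have hM : 0 < log n := Real.log_pos (by linarith)
  set K := ⌊Λ / log p⌋₊ with hK
  have hK1 : (K : ℝ) ≤ Λ / log p := Nat.floor_le (by positivity)
  have hK2 : Λ / log p < K + 1 := Nat.lt_floor_add_one _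
  have h := lower_general p hp K n
  have hC := lowC_pos p hp K
  have h1 : log (((n : ℝ) + 1) ^ K * lowC p K) ≤ log (qPow p n) :=
    Real.log_le_log (by positivity) h
  rw [Real.log_mul (by positivity) (by positivity), Real.log_pow] at h1
  have h2 := log_lowC p hp K
  have h3 : log n ≤ log ((n : ℝ) + 1) := Real.log_le_log (by positivity) (by linarith)
  have h4 : (K : ℝ) * log n ≤ K * log ((n : ℝ) + 1) := by gcongr
  have h5 : (K : ℝ) + 1 ≤ log n / log p := by
    have : Λ / log p + 1 ≤ log n / log p := by
      rw [div_add_one hL.ne']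
      gcongr
      linarith
    linarith
  have h6 : log ((K : ℝ) + 1) ≤ log (log n) - log (log p) := by
    rw [← Real.log_div (by positivity) (by positivity)]
    exact Real.log_le_log (by positivity) h5
  have h7 : ((K : ℝ) + 1) * log ((K : ℝ) + 1) ≤ (K + 1) * (log (log n) - log (log p)) := by
    gcongr
  have h8 := (floor_identity (log p) Λ K hL hK1 hK2).2
  have h9 : (K : ℝ) * Λ = K * log n - K * (log (log n) - log (log p)) := by rw [hΛ]; ring
  have h10 : Λ / log p = log n / log p - (log (log n) - log (log p)) / log p := by
    rw [hΛ]; ring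
  linarith

lemma target_compare (M L : ℝ) (hL : 0 < L) (Λ : ℝ) (hΛ : Λ = M - log M + log L)
    (hM : 2 * L ≤ M) (hM1 : 0 ≤ M - log M - L) (hl : 0 ≤ log M) :
    |(1 / (2 * L)) * (M - L - log (M - L)) ^ 2 + (1 / 2 + 1 / L + log L / L) * M -
      (Λ ^ 2 / (2 * L) - Λ / 2 + M / L)| ≤
    |log M - log L| * |1 / 2 + log L / L| + (log L + L) ^ 2 / (2 * L) + (2 + 1 / (2 * L)) := by
  have hM0 : 0 < M := by linarith
  set d : ℝ := log (M - L) - log M with hd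
  have hd0 : d ≤ 0 := by
    have : log (M - L) ≤ log M := Real.log_le_log (by linarith) (by linarith)
    linarith
  have hd1 : -(2 * L / M) ≤ d := by
    have h1 := Real.one_sub_inv_le_log_of_pos (show 0 < (M - L) / M by
      apply div_pos <;> linarith)
    rw [Real.log_div (by linarith) (by linarith), inv_div] at h1
    have h2 : M / (M - L) ≤ 1 + 2 * L / M := by
      rw [div_le_iff₀ (by linarith)]
      have : (1 + 2 * L / M) * (M - L) = M + L * (M - 2 * L) / M := by field_simp; ring
      rw [this]
      have : 0 ≤ L * (M - 2 * L) / M := by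
        apply div_nonneg _ hM0.le
        apply mul_nonneg <;> linarith
      linarith
    linarith
  have hdM : -(2 * L) ≤ d * M := by
    have := mul_le_mul_of_nonneg_right hd1 hM0.le
    have h2 : -(2 * L / M) * M = -(2 * L) := by field_simp
    linarith
  have hd2 : -1 ≤ d := by
    have : 2 * L / M ≤ 1 := by rw [div_le_one hM0]; exact hM
    linarith
  have hg : log (M - L) = log M + d := by rw [hd]; ring
  have hid : (1 / (2 * L)) * (M - L - log (M - L)) ^ 2 + (1 / 2 + 1 / L + log L / L) * M -
      (Λ ^ 2 / (2 * L) - Λ / 2 + M / L) =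
      (log M - log L) * (1 / 2 + log L / L) + (log L + L) ^ 2 / (2 * L) +
       ((-d) * (M - log M - L) / L + d ^ 2 / (2 * L)) := by
    rw [hg, hΛ]; field_simp; ring
  rw [hid]
  have e1 : 0 ≤ (-d) * (M - log M - L) / L :=
    div_nonneg (mul_nonneg (by linarith) hM1) hL.le
  have e2 : (-d) * (M - log M - L) / L ≤ 2 := by
    rw [div_le_iff₀ hL]
    nlinarith
  have e3 : d ^ 2 / (2 * L) ≤ 1 / (2 * L) := by
    gcongr
    nlinarith
  have e4 : 0 ≤ d ^ 2 / (2 * L) := by positivity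
  have e5 : 0 ≤ (log L + L) ^ 2 / (2 * L) := by positivity
  refine (abs_add_le _ _).trans (add_le_add ((abs_add_le _ _).trans (add_le_add ?_ ?_)) ?_)
  · rw [abs_mul]
  · rw [abs_of_nonneg e5]
  · rw [abs_of_nonneg (by linarith)]
    linarith

/-- Mahler's estimate: `log q_p(n) = (1/(2 log p))(log((n/p)/log(n/p)))² +
(1/2 + 1/log p + (log log p)/log p)·log n + O_p(log log n)`. -/
theorem mahler_qPow (p : ℕ) (hp : 2 ≤ p) :
    ∃ N : ℕ, ∃ C : ℝ, 0 < C ∧ ∀ n : ℕ, N ≤ n →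
      |Real.log (qPow p n) -
          ((1 / (2 * Real.log p)) *
              (Real.log (((n : ℝ) / p) / Real.log ((n : ℝ) / p))) ^ 2 +
            (1 / 2 + 1 / Real.log p + Real.log (Real.log p) / Real.log p) *
              Real.log n)| ≤
        C * Real.log (Real.log n) := by

  have hp' : (2 : ℝ) ≤ p := by exact_mod_cast hp
  have hL : 0 < Real.log p := Real.log_pos (by linarith)
  set L := Real.log p with hLdef
  set A := |1 / 2 + Real.log L / L| with hA
  set B := |Real.log L| with hB
  have hA0 : 0 ≤ A := abs_nonneg _
  have hB0 : 0 ≤ B := abs_nonneg _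
  have hT1 : Filter.Tendsto (fun n : ℕ => Real.log (n : ℝ)) Filter.atTop Filter.atTop :=
    Real.tendsto_log_atTop.comp tendsto_natCast_atTop_atTop
  have hT2 : Filter.Tendsto (fun n : ℕ => Real.log (Real.log (n : ℝ))) Filter.atTop Filter.atTop :=
    Real.tendsto_log_atTop.comp hT1
  have hT3 : ∀ᶠ n : ℕ in Filter.atTop,
      Real.log (Real.log (n : ℝ)) ≤ (1 / 2) * Real.log (n : ℝ) := by
    have h1 := (Real.isLittleO_log_id_atTop.bound (show (0 : ℝ) < 1 / 2 by norm_num))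
    filter_upwards [hT1.eventually h1, hT1.eventually_ge_atTop 0] with n hn hn0
    simp only [id, Real.norm_eq_abs] at hn
    rw [abs_of_nonneg hn0] at hn
    exact (le_abs_self _).trans hn
  have hev := (hT3.and (((hT1.eventually_ge_atTop (2 * L + 2 * B)).and
    (hT2.eventually_ge_atTop (1 + B + L))).and (Filter.eventually_ge_atTop 2)))
  obtain ⟨N, hN⟩ := Filter.eventually_atTop.1 hev
  have hc0 : 0 ≤ (Real.log L + L) ^ 2 / (2 * L) + (2 + 1 / (2 * L)) := by positivity
  set c := (Real.log L + L) ^ 2 / (2 * L) + (2 + 1 / (2 * L)) with hc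
  have hcoef : 0 ≤ 1 / L := by positivity
  refine ⟨N, (1 + B) * A + c + (p + 2 + L) + (L + 1 + (1 + B) / L + (1 + B)), by positivity, ?_⟩
  intro n hn
  obtain ⟨h3, ⟨h1, h2⟩, hn2⟩ := hN n hn
  have hn' : (2 : ℝ) ≤ n := by exact_mod_cast hn2
  set M := Real.log (n : ℝ) with hM
  set l := Real.log M with hl
  have hl1 : 1 ≤ l := by linarith
  have hBl : -B ≤ Real.log L := neg_abs_le _
  have hBu : Real.log L ≤ B := le_abs_self _
  have hq : 0 < qPow p n := by
    have := lower_general p hp 0 n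
    simp [lowC] at this
    omega
  have hlogdiv : Real.log ((n : ℝ) / p) = M - L := Real.log_div (by positivity) (by positivity)
  have hW : Real.log (((n : ℝ) / p) / Real.log ((n : ℝ) / p)) = M - L - Real.log (M - L) := by
    rw [hlogdiv, Real.log_div (by positivity) (by linarith), hlogdiv]
  rw [hW]
  have hΛ0 : 0 ≤ M - l + Real.log L := by linarith
  have u := upper_final p hp n hn2 _ rfl hΛ0 hq
  have v := lower_final p hp n hn2 _ rfl hΛ0 (by linarith)
  have w := target_compare M L hL _ rfl (by linarith) (by linarith) (by linarith)
  rw [← hLdef, ← hM, ← hl] at u v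
  rw [← hl, ← hA, add_assoc (|l - Real.log L| * A), ← hc] at w
  have hlB : |l - Real.log L| ≤ (1 + B) * l := by
    rw [abs_le]; constructor <;> nlinarith
  have k1 : |l - Real.log L| * A ≤ (1 + B) * l * A := mul_le_mul_of_nonneg_right hlB hA0
  have k2 : l - Real.log L ≤ (1 + B) * l := (le_abs_self _).trans hlB
  have k3 : (l - Real.log L) / L ≤ (1 + B) * l / L := div_le_div_of_nonneg_right k2 hL.le
  have k4 : (1 + B) * l / L = (1 + B) / L * l := by ring
  have k5 : c ≤ c * l := le_mul_of_one_le_right hc0 hl1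
  have k6 : (p + 2 + L) ≤ (p + 2 + L) * l := le_mul_of_one_le_right (by positivity) hl1
  have k7 : (L + 1) ≤ (L + 1) * l := le_mul_of_one_le_right (by positivity) hl1
  have k8 : 0 ≤ (1 + B) / L * l := by positivity
  have k9 : 0 ≤ (1 + B) * l := by positivity
  have hCl : ((1 + B) * A + c + (p + 2 + L) + (L + 1 + (1 + B) / L + (1 + B))) * l =
    (1 + B) * l * A + c * l + (p + 2 + L) * l + ((L + 1) * l + (1 + B) / L * l + (1 + B) * l) := by
    ring
  rw [hCl]
  rw [abs_le] at w ⊢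
  obtain ⟨w1, w2⟩ := w
  constructor
  · linarith
  · linarith
end
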